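/- arXiv:0710.5213 — 2 statements merged into one kernel-verified Lean document; each statement's English description precedes it below -/
import Mathlib

section
/- The system of functions 𝔢_{n,c} on the unit circle, defined by 𝔢_{2m,c}(τ) = b_κ(τ)^m b_{κ̄}(τ)^m K_{κ̄}(τ) e^{ic} and 𝔢_{2m+1,c}(τ) = b_κ(τ)^m b_{κ̄}(τ)^{m+1} K_κ(τ), forms an orthonormal basis of the Hardy space H² when n ranges over ℤ₊ and an orthonormal basis of L²(𝕋) when n ranges over ℤ; moreover, with respect to this basis the operator of multiplication by v(τ) = b_κ(τ)/b_{κ̄}(τ) is the CMV matrix 𝔄_a with constant Verblunsky coefficients a_n = a = e^{ic} sin(ξ₀/2) for all n. -/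
open MeasureTheory Complex ComplexConjugate Filter
open scoped ComplexOrder

noncomputable section

local notation "π" => Real.pi

/-- The point `e^{iθ}` on the unit circle. -/
def circPt (θ : ℝ) : ℂ := Complex.exp (θ * Complex.I)

/-- Normalized Lebesgue integral `∫ dm` over the unit circle, of a complex-valued function. -/
def mInt (f : ℂ → ℂ) : ℂ := (((2 * π : ℝ)) : ℂ)⁻¹ * ∫ θ in (0:ℝ)..(2*π), f (circPt θ)

/-- Normalized Lebesgue integral `∫ dm` over the unit circle, of a real-valued function. -/
def mIntR (f : ℂ → ℝ) : ℝ := (2 * π)⁻¹ * ∫ θ in (0:ℝ)..(2*π), f (circPt θ)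

/-- The open unit disc 𝔻. -/
def UD : Set ℂ := Metric.ball 0 1

/-- The point κ = -i·tan((π-ξ₀)/4). -/
def kpt (ξ₀ : ℝ) : ℂ := -Complex.I * (Real.tan ((π - ξ₀)/4) : ℝ)

/-- The normalized Blaschke factor b_κ, with b_κ(κ̄) > 0. -/
def bk (ξ₀ : ℝ) (ζ : ℂ) : ℂ := Complex.I⁻¹ * (ζ - kpt ξ₀) / (1 - ζ * conj (kpt ξ₀))

/-- The normalized Blaschke factor b_{κ̄}, with b_{κ̄}(κ) > 0. -/
def bkb (ξ₀ : ℝ) (ζ : ℂ) : ℂ := Complex.I * (ζ - conj (kpt ξ₀)) / (1 - ζ * kpt ξ₀)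

/-- The conformal map v = b_κ / b_{κ̄} of 𝔻 onto ℂ̄ ∖ E, v(κ)=0, v(κ̄)=∞. -/
def vmap (ξ₀ : ℝ) (ζ : ℂ) : ℂ := bk ξ₀ ζ / bkb ξ₀ ζ

/-- The normalized reproducing kernel K_{ζ₀}(ζ) = √(1-|ζ₀|²)/(1-ζ·conj ζ₀) of H². -/
def Kker (ζ₀ ζ : ℂ) : ℂ := (Real.sqrt (1 - ‖ζ₀‖^2) : ℂ) / (1 - ζ * conj ζ₀)

/-- ρ = √(1-|a|²). -/
def rho (a : ℂ) : ℂ := (Real.sqrt (1 - ‖a‖^2) : ℂ)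

/-- The free orthonormal system 𝔢_{n,c}:
𝔢_{2m,c} = b_κ^m b_{κ̄}^m K_{κ̄} e^{ic},  𝔢_{2m+1,c} = b_κ^m b_{κ̄}^{m+1} K_κ. -/
def freeSys (ξ₀ c : ℝ) (n : ℤ) (ζ : ℂ) : ℂ :=
  if Even n then
    (bk ξ₀ ζ) ^ (n/2) * (bkb ξ₀ ζ) ^ (n/2) * Kker (conj (kpt ξ₀)) ζ *
      Complex.exp (c * Complex.I)
  else
    (bk ξ₀ ζ) ^ ((n-1)/2) * (bkb ξ₀ ζ) ^ ((n+1)/2) * Kker (kpt ξ₀) ζ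

/-- The block-diagonal unitary 𝔄₀ (blocks A_{2j} on rows/columns 2j, 2j+1). -/
def CMV0 (a : ℤ → ℂ) (f : ℤ → ℂ) : ℤ → ℂ := fun n =>
  if Even n then conj (a n) * f n + rho (a n) * f (n+1)
  else rho (a (n-1)) * f (n-1) - a (n-1) * f n

/-- The block-diagonal unitary 𝔄₁ (blocks A_{2j+1} on rows/columns 2j+1, 2j+2). -/
def CMV1 (a : ℤ → ℂ) (f : ℤ → ℂ) : ℤ → ℂ := fun n =>
  if Even n then rho (a (n-1)) * f (n-1) - a (n-1) * f n
  else conj (a n) * f n + rho (a n) * f (n+1)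

/-- The CMV operator 𝔄 = 𝔄₀𝔄₁ acting on sequences. -/
def CMVop (a : ℤ → ℂ) (f : ℤ → ℂ) : ℤ → ℂ := CMV0 a (CMV1 a f)

/-- 𝔄₀⁻¹ = 𝔄₀*. -/
def CMV0inv (a : ℤ → ℂ) (f : ℤ → ℂ) : ℤ → ℂ := fun n =>
  if Even n then a n * f n + rho (a n) * f (n+1)
  else rho (a (n-1)) * f (n-1) - conj (a (n-1)) * f n

/-- 𝔄₁⁻¹ = 𝔄₁*. -/
def CMV1inv (a : ℤ → ℂ) (f : ℤ → ℂ) : ℤ → ℂ := fun n =>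
  if Even n then rho (a (n-1)) * f (n-1) - conj (a (n-1)) * f n
  else a n * f n + rho (a n) * f (n+1)

/-- 𝔄⁻¹ = 𝔄₁⁻¹𝔄₀⁻¹. -/
def CMVinv (a : ℤ → ℂ) (f : ℤ → ℂ) : ℤ → ℂ := CMV1inv a (CMV0inv a f)

/-- Integer powers 𝔄ⁿ of the CMV operator. -/
def CMVpow (a : ℤ → ℂ) (n : ℤ) (f : ℤ → ℂ) : ℤ → ℂ :=
  if 0 ≤ n then (CMVop a)^[n.toNat] f else (CMVinv a)^[(-n).toNat] f

/-- The standard basis vector |n⟩ of l²(ℤ). -/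
def deltaVec (n : ℤ) : ℤ → ℂ := fun m => if m = n then 1 else 0

/-- Boundary description of the Hardy space H²: square-integrable on 𝕋 with vanishing
negative Fourier coefficients. -/
def MemH2 (f : ℂ → ℂ) : Prop :=
  Measurable (fun θ : ℝ => f (circPt θ)) ∧
  IntervalIntegrable (fun θ : ℝ => ‖f (circPt θ)‖^2) volume 0 (2*π) ∧
  ∀ k : ℕ, 0 < k → mInt (fun τ => f τ * τ^(k:ℕ)) = 0

/-- The analytic (Cauchy) extension into 𝔻 of a boundary function. -/
def h2ext (f : ℂ → ℂ) (ζ : ℂ) : ℂ := mInt (fun τ => f τ / (1 - ζ * conj τ))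

/-- The Blaschke factor (|w|/w)·(w-ζ)/(1-ζ·conj w), with the factor ζ when w = 0. -/
def blFactor (w ζ : ℂ) : ℂ :=
  if w = 0 then ζ else ((‖w‖ : ℂ) / w) * ((w - ζ) / (1 - ζ * conj w))

/-- The Blaschke product over the set Z = {ζs k}. -/
def Bprod (ζs : ℕ → ℂ) (ζ : ℂ) : ℂ := ∏' k, blFactor (ζs k) ζ

/-- A divisor B_N of B such that B/B_N is a finite Blaschke product. -/
def BprodAway (ζs : ℕ → ℂ) (F : Finset ℕ) (ζ : ℂ) : ℂ :=
  ∏' k, if k ∈ F then 1 else blFactor (ζs k) ζ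

/-- The (real) value of the Faddeev–Marchenko quadratic form
[conj f(τ), τ·conj f(τ̄)]·[[1, conj R],[R, 1]]·[f(τ); τ̄ f(τ̄)]. -/
def FMform (R : ℂ → ℂ) (f : ℂ → ℂ) (τ : ℂ) : ℝ :=
  ‖f τ‖^2 + ‖f (conj τ)‖^2 + 2 * (R τ * f τ * τ * conj (f (conj τ))).re

/-- The squared Faddeev–Marchenko norm ‖f‖²_{α}. -/
def FMnormSq (R : ℂ → ℂ) (ζs : ℕ → ℂ) (ν : ℕ → ℝ) (f : ℂ → ℂ) : ℝ :=
  (∑' k, ν k * ‖f (ζs k)‖^2) + (1/2) * mIntR (FMform R f)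

/-- The Faddeev–Marchenko inner product ⟨f,g⟩_{α}. -/
def FMinner (R : ℂ → ℂ) (ζs : ℕ → ℂ) (ν : ℕ → ℝ) (f g : ℂ → ℂ) : ℂ :=
  (∑' k, (ν k : ℂ) * f (ζs k) * conj (g (ζs k)))
  + (1/2 : ℂ) * mInt (fun τ =>
      conj (g τ) * (f τ + conj (R τ) * conj τ * f (conj τ))
      + τ * conj (g (conj τ)) * (R τ * f τ + conj τ * f (conj τ)))

/-- Membership in the Faddeev–Marchenko space L²_α, α = {R,ν}. -/
def MemFM (R : ℂ → ℂ) (ζs : ℕ → ℂ) (ν : ℕ → ℝ) (f : ℂ → ℂ) : Prop :=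
  Measurable (fun θ : ℝ => f (circPt θ)) ∧
  IntervalIntegrable (fun θ : ℝ => FMform R f (circPt θ)) volume 0 (2*π) ∧
  Summable (fun k => ν k * ‖f (ζs k)‖^2)

/-- The Hardy-type space Ȟ²_α : the closure in L²_α of the functions B_N·g,
g a polynomial (equivalently H^∞), B_N a divisor of B with B/B_N finite. -/
def MemCheckH2 (R : ℂ → ℂ) (ζs : ℕ → ℂ) (ν : ℕ → ℝ) (f : ℂ → ℂ) : Prop :=
  MemFM R ζs ν f ∧
  ∀ ε > (0:ℝ), ∃ (F : Finset ℕ) (p : Polynomial ℂ),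
    FMnormSq R ζs ν (fun z => f z - BprodAway ζs F z * p.eval z) < ε

/-- The Hardy-type space Ĥ²_α : f ∈ L²_α with B·T·f ∈ H², the values at the points
ζ_k of Z being given by analytic continuation. -/
def MemHatH2 (R : ℂ → ℂ) (ζs : ℕ → ℂ) (ν : ℕ → ℝ) (T : ℂ → ℂ) (f : ℂ → ℂ) : Prop :=
  MemFM R ζs ν f ∧
  MemH2 (fun τ => Bprod ζs τ * T τ * f τ) ∧
  ∀ k, f (ζs k) * h2ext (fun τ => Bprod ζs τ * T τ) (ζs k)
        = h2ext (fun τ => Bprod ζs τ * T τ * f τ) (ζs k)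

/-- Outer function in 𝔻 (its own boundary values being used in the Poisson formula). -/
def IsOuter (O : ℂ → ℂ) : Prop :=
  DifferentiableOn ℂ O UD ∧ (∀ ζ ∈ UD, O ζ ≠ 0) ∧
  ∀ ζ ∈ UD, Real.log ‖O ζ‖ =
    (2*π)⁻¹ * ∫ θ in (0:ℝ)..(2*π),
      ((1 - ‖ζ‖^2) / ‖circPt θ - ζ‖^2) * Real.log ‖O (circPt θ)‖

/-- O is the outer function attached to the reflection coefficient R:
|O|² + |R|² = 1 a.e. on 𝕋. -/
def OuterFor (R : ℂ → ℂ) (O : ℂ → ℂ) : Prop :=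
  IsOuter O ∧ Measurable (fun θ : ℝ => O (circPt θ)) ∧
  ∀ᵐ θ ∂(volume.restrict (Set.Ioc (0:ℝ) (2*π))),
    ‖O (circPt θ)‖^2 + ‖R (circPt θ)‖^2 = 1

/-- The transmission coefficient T₋ = O/B (as analytic continuation into 𝔻). -/
def TmOf (ζs : ℕ → ℂ) (O : ℂ → ℂ) : ℂ → ℂ := fun ζ => O ζ / Bprod ζs ζ

/-- The transmission coefficient T₊(ζ) = conj(T₋(conj ζ)). -/
def TpOf (ζs : ℕ → ℂ) (O : ℂ → ℂ) : ℂ → ℂ := fun ζ => conj (TmOf ζs O (conj ζ))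

/-- The reflection coefficient R₋ = -(T₋/conj T₊)·conj R₊. -/
def RmOf (ζs : ℕ → ℂ) (O : ℂ → ℂ) (Rp : ℂ → ℂ) : ℂ → ℂ :=
  fun τ => -(TmOf ζs O τ / conj (TpOf ζs O τ)) * conj (Rp τ)

/-- The dual discrete measure ν₋, via 1/(ν₊ν₋)(ζ_k) = |(1/T₋)'(ζ_k)|². -/
def nuMinusOf (ζs : ℕ → ℂ) (O : ℂ → ℂ) (νp : ℕ → ℝ) : ℕ → ℝ :=
  fun k => (νp k * ‖deriv (fun z => (TmOf ζs O z)⁻¹) (ζs k)‖^2)⁻¹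

/-- f has interior values pinned by analytic continuation: w·f in 𝔻 is the Cauchy
extension of its boundary values. -/
def PinnedBy (w : ℂ → ℂ) (f : ℂ → ℂ) : Prop :=
  ∀ ζ ∈ UD, w ζ * f ζ = h2ext (fun τ => w τ * f τ) ζ

/-- k is the reproducing kernel at ζ₀ of the subspace `mem` w.r.t. the inner product `inn`. -/
def IsRK (mem : (ℂ → ℂ) → Prop) (inn : (ℂ → ℂ) → (ℂ → ℂ) → ℂ)
    (k : ℂ → ℂ) (ζ₀ : ℂ) : Prop :=
  mem k ∧ ∀ f, mem f → inn f k = f ζ₀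

/-- The normalized reproducing kernel K = k/‖k‖ = k/√(k(ζ₀,ζ₀)). -/
def NKer (k : ℂ → ℂ) (ζ₀ ζ : ℂ) : ℂ := k ζ / (Real.sqrt ((k ζ₀).re) : ℂ)

/-- Shift of the reflection coefficient: R ↦ b_κⁿ b_{κ̄}ⁿ R. -/
def shiftR (ξ₀ : ℝ) (n : ℤ) (R : ℂ → ℂ) : ℂ → ℂ :=
  fun τ => (bk ξ₀ τ)^n * (bkb ξ₀ τ)^n * R τ

/-- Shift of the discrete measure: ν ↦ b_κⁿ b_{κ̄}ⁿ ν (positive on the real points ζ_k). -/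
def shiftNu (ξ₀ : ℝ) (ζs : ℕ → ℂ) (n : ℤ) (ν : ℕ → ℝ) : ℕ → ℝ :=
  fun k => ((bk ξ₀ (ζs k))^n * (bkb ξ₀ (ζs k))^n).re * ν k

/-- A discrete measure μ on the points ζs is a Carleson measure in 𝔻. -/
def IsCarleson (ζs : ℕ → ℂ) (μ : ℕ → ℝ) : Prop :=
  ∃ C : ℝ, 0 ≤ C ∧ ∀ (θ₀ h : ℝ), 0 < h →
    (∑' k, if 1 - h ≤ ‖ζs k‖ ∧ |Complex.arg (ζs k / circPt θ₀)| ≤ h/2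
      then μ k else 0) ≤ C * h

/-- θ is a Schur function whose Schur parameters are the sequence γ. -/
def IsSchurWithParams (θ : ℂ → ℂ) (γ : ℕ → ℂ) : Prop :=
  ∃ Θ : ℕ → ℂ → ℂ, Θ 0 = θ ∧
    (∀ n, DifferentiableOn ℂ (Θ n) UD ∧ ∀ ζ ∈ UD, ‖Θ n ζ‖ ≤ 1) ∧
    (∀ n, γ n = Θ n 0) ∧
    ∀ n, ∀ ζ ∈ UD, Θ n ζ * (1 + ζ * conj (γ n) * Θ (n+1) ζ) = γ n + ζ * Θ (n+1) ζ

/-- The entries M_{l,n} of the Gelfand–Levitan–Marchenko transformation operator: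
e(n,τ) = Σ_{l} M_{l,n} 𝔢_{l,c}(τ). -/
def GLMentry (ξ₀ c : ℝ) (e : ℤ → ℂ → ℂ) (l n : ℤ) : ℂ :=
  mInt fun τ => e n τ * conj (freeSys ξ₀ c l τ)

/-- Boundedness of the GLM transformation operator on l²(ℤ₊). -/
def GLMBounded (ξ₀ c : ℝ) (e : ℤ → ℂ → ℂ) : Prop :=
  ∃ C : ℝ, 0 ≤ C ∧ ∀ (s : Finset ℤ), (∀ i ∈ s, 0 ≤ i) → ∀ x : ℤ → ℂ,
    ∑' l : ℕ, ‖∑ n ∈ s, GLMentry ξ₀ c e (l:ℤ) n * x n‖^2 ≤ C * ∑ n ∈ s, ‖x n‖^2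

/-- The angle in [0,2π) of a point of the unit circle. -/
def angOf (t : ℂ) : ℝ := if 0 ≤ t.arg then t.arg else t.arg + 2*π

/-- A CMV matrix of the Szegő–Blaschke class 𝔄_SB(E): Verblunsky coefficients a,
spectrum E ∪ X with X = {v(ζ_k)} (the ζ_k real, satisfying the Blaschke condition),
the 2×2 matrix spectral measure (w.r.t. the cyclic subspace spanned by |-1⟩, |0⟩)
being W(ξ)dm on E plus the point masses σpt at v(ζ_k), with the Szegő condition
log det W(v(τ)) ∈ L¹(𝕋). -/
structure SBOperator (ξ₀ : ℝ) where
  hxi : 0 < ξ₀ ∧ ξ₀ < π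
  a : ℤ → ℂ
  ha : ∀ j, ‖a j‖ < 1
  ζs : ℕ → ℂ
  hreal : ∀ k, (ζs k).im = 0
  hmod : ∀ k, ‖ζs k‖ < 1
  hinj : Function.Injective ζs
  hblaschke : Summable fun k => 1 - ‖ζs k‖
  W : ℝ → Matrix (Fin 2) (Fin 2) ℂ
  σpt : ℕ → Matrix (Fin 2) (Fin 2) ℂ
  hWpsd : ∀ ξ ∈ Set.Icc ξ₀ (2*π - ξ₀), (W ξ).PosSemidef
  hWint : ∀ i j : Fin 2, IntervalIntegrable (fun ξ => W ξ i j) volume ξ₀ (2*π - ξ₀)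
  hσpsd : ∀ k, (σpt k).PosSemidef
  hσne : ∀ k, σpt k ≠ 0
  hσsum : ∀ i j : Fin 2, Summable fun k => ‖σpt k i j‖
  hSzego : IntervalIntegrable
    (fun θ => Real.log ‖(W (angOf (vmap ξ₀ (circPt θ)))).det‖) volume 0 (2*π)
  hmoment : ∀ n : ℤ, ∀ i j : Fin 2,
    CMVpow a n (deltaVec (((i:ℕ):ℤ) - 1)) (((j:ℕ):ℤ) - 1)
      = (((2*π : ℝ)) : ℂ)⁻¹ * (∫ ξ in ξ₀..(2*π - ξ₀), (circPt ξ)^n * W ξ j i)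
        + ∑' k, (vmap ξ₀ (ζs k))^n * σpt k j i

/-- The scattering apparatus attached to a CMV matrix 𝔄 ∈ 𝔄_SB(E): the generalized
eigenvectors e^±(n,·) satisfying the CMV three-term recurrences and the scattering
asymptotics with reflection/transmission coefficients R_±, T_± and constants e^{ic_±},
and the discrete measures ν_± defined by 1/ν_±(ζ_k) = Σ_n |e^±(n,ζ_k)|². -/
structure ScatteringOf {ξ₀ : ℝ} (M : SBOperator ξ₀) where
  cp : ℝ
  cm : ℝ
  Rp : ℂ → ℂ
  Rm : ℂ → ℂ
  Tp : ℂ → ℂ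
  Tm : ℂ → ℂ
  ep : ℤ → ℂ → ℂ
  em : ℤ → ℂ → ℂ
  νp : ℕ → ℝ
  νm : ℕ → ℝ
  hrecp : ∀ (τ : ℂ), ‖τ‖ = 1 → ∀ m : ℤ,
    vmap ξ₀ τ * (ep (2*m-1) τ * rho (M.a (2*m-1)) - ep (2*m) τ * conj (M.a (2*m-1)))
      = ep (2*m) τ * M.a (2*m) + ep (2*m+1) τ * rho (M.a (2*m)) ∧
    (vmap ξ₀ τ)⁻¹ * (ep (2*m) τ * rho (M.a (2*m)) - ep (2*m+1) τ * M.a (2*m))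
      = ep (2*m+1) τ * M.a (2*m+1) + ep (2*m+2) τ * rho (M.a (2*m+1))
  hrecm : ∀ (τ : ℂ), ‖τ‖ = 1 → ∀ m : ℤ,
    vmap ξ₀ τ * (em (-2*m) τ * rho (M.a (2*m-1)) - em (-2*m-1) τ * conj (M.a (2*m-1)))
      = em (-2*m-1) τ * M.a (2*m) + em (-2*m-2) τ * rho (M.a (2*m)) ∧
    (vmap ξ₀ τ)⁻¹ * (em (-2*m-1) τ * rho (M.a (2*m)) - em (-2*m-2) τ * M.a (2*m))
      = em (-2*m-2) τ * M.a (2*m+1) + em (-2*m-3) τ * rho (M.a (2*m+1))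
  hasympp1 : Tendsto (fun n : ℕ =>
      mIntR fun τ => ‖Tp τ * ep (-(n:ℤ)-1) τ
        - (conj τ * freeSys ξ₀ cm (n:ℤ) (conj τ) + Rm τ * freeSys ξ₀ cm (n:ℤ) τ)‖^2)
      atTop (nhds 0)
  hasympp2 : Tendsto (fun n : ℕ =>
      mIntR fun τ => ‖Tp τ * ep (n:ℤ) τ - Tp τ * freeSys ξ₀ cp (n:ℤ) τ‖^2)
      atTop (nhds 0)
  hasympm1 : Tendsto (fun n : ℕ =>
      mIntR fun τ => ‖Tm τ * em (-(n:ℤ)-1) τ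
        - (conj τ * freeSys ξ₀ cp (n:ℤ) (conj τ) + Rp τ * freeSys ξ₀ cp (n:ℤ) τ)‖^2)
      atTop (nhds 0)
  hasympm2 : Tendsto (fun n : ℕ =>
      mIntR fun τ => ‖Tm τ * em (n:ℤ) τ - Tm τ * freeSys ξ₀ cm (n:ℤ) τ‖^2)
      atTop (nhds 0)
  hsump : ∀ k, Summable fun n : ℤ => ‖ep n (M.ζs k)‖^2
  hsumm : ∀ k, Summable fun n : ℤ => ‖em n (M.ζs k)‖^2
  hνp : ∀ k, (νp k)⁻¹ = ∑' n : ℤ, ‖ep n (M.ζs k)‖^2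
  hνm : ∀ k, (νm k)⁻¹ = ∑' n : ℤ, ‖em n (M.ζs k)‖^2
  hνppos : ∀ k, 0 < νp k
  hνmpos : ∀ k, 0 < νm k

/-- Scattering data α₊ = {R₊, ν₊} of the Szegő–Blaschke class A_SB(E). -/
structure SBData (ξ₀ : ℝ) where
  hxi : 0 < ξ₀ ∧ ξ₀ < π
  Rp : ℂ → ℂ
  ζs : ℕ → ℂ
  νp : ℕ → ℝ
  hRmeas : Measurable fun θ : ℝ => Rp (circPt θ)
  hRcontr : ∀ τ : ℂ, ‖τ‖ = 1 → ‖Rp τ‖ ≤ 1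
  hRsymm : ∀ τ : ℂ, ‖τ‖ = 1 → Rp τ = conj (Rp (conj τ))
  hSzego : IntervalIntegrable (fun θ => Real.log (1 - ‖Rp (circPt θ)‖^2)) volume 0 (2*π)
  hreal : ∀ k, (ζs k).im = 0
  hmod : ∀ k, ‖ζs k‖ < 1
  hinj : Function.Injective ζs
  hblaschke : Summable fun k => 1 - ‖ζs k‖
  hν : ∀ k, 0 < νp k

/-- Two scattering systems have the same scattering data {R₊, ν₊}, e^{ic₊}. -/
def SameData {ξ₀ : ℝ} {M M' : SBOperator ξ₀} (sc : ScatteringOf M)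
    (sc' : ScatteringOf M') : Prop :=
  M.ζs = M'.ζs ∧ sc.νp = sc'.νp ∧ sc.cp = sc'.cp ∧
  ∀ τ : ℂ, ‖τ‖ = 1 → sc.Rp τ = sc'.Rp τ

/-- A scattering system realizes the given scattering data (D, e^{ic₊}). -/
def HasData {ξ₀ : ℝ} {M : SBOperator ξ₀} (sc : ScatteringOf M)
    (D : SBData ξ₀) (c : ℝ) : Prop :=
  M.ζs = D.ζs ∧ sc.νp = D.νp ∧ sc.cp = c ∧
  ∀ τ : ℂ, ‖τ‖ = 1 → sc.Rp τ = D.Rp τ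

end

noncomputable section

open MeasureTheory Complex ComplexConjugate

local notation "π" => Real.pi

section HalfAngle

variable {ξ₀ : ℝ}

/-- The modulus of `κ`. -/
def tanParam (ξ₀ : ℝ) : ℝ := Real.tan ((π - ξ₀) / 4)

theorem tanParam_pos (h0 : 0 < ξ₀) (h1 : ξ₀ < π) : 0 < tanParam ξ₀ :=
  Real.tan_pos_of_pos_of_lt_pi_div_two (by linarith) (by linarith)

theorem tanParam_lt_one (h0 : 0 < ξ₀) (h1 : ξ₀ < π) : tanParam ξ₀ < 1 := by
  rw [← Real.tan_pi_div_four]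
  exact Real.tan_lt_tan_of_lt_of_lt_pi_div_two (by linarith) (by linarith) (by linarith)

theorem cos_quarter_pos (h0 : 0 < ξ₀) (h1 : ξ₀ < π) : 0 < Real.cos ((π - ξ₀) / 4) :=
  Real.cos_pos_of_mem_Ioo ⟨by linarith, by linarith⟩

theorem sin_half_eq (h0 : 0 < ξ₀) (h1 : ξ₀ < π) :
    Real.sin (ξ₀ / 2) = (1 - tanParam ξ₀ ^ 2) / (1 + tanParam ξ₀ ^ 2) := by
  have hc := (cos_quarter_pos h0 h1).ne'
  have hs := Real.sin_sq_add_cos_sq ((π - ξ₀) / 4)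
  have : Real.sin (ξ₀ / 2) = Real.cos (2 * ((π - ξ₀) / 4)) := by
    rw [← Real.cos_pi_div_two_sub]
    ring_nf
  rw [this, Real.cos_two_mul', tanParam, Real.tan_eq_sin_div_cos]
  field_simp
  rw [add_comm, hs]
  ring

theorem cos_half_eq (h0 : 0 < ξ₀) (h1 : ξ₀ < π) :
    Real.cos (ξ₀ / 2) = 2 * tanParam ξ₀ / (1 + tanParam ξ₀ ^ 2) := by
  have hc := (cos_quarter_pos h0 h1).ne'
  have hs := Real.sin_sq_add_cos_sq ((π - ξ₀) / 4)
  have : Real.cos (ξ₀ / 2) = Real.sin (2 * ((π - ξ₀) / 4)) := by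
    rw [← Real.sin_pi_div_two_sub]
    ring_nf
  rw [this, Real.sin_two_mul, tanParam, Real.tan_eq_sin_div_cos]
  field_simp
  rw [add_comm, hs]
  ring

end HalfAngle

section Factors

variable {ξ₀ : ℝ} {z : ℂ}

theorem kpt_eq : kpt ξ₀ = -(I * tanParam ξ₀) := by
  rw [kpt, tanParam]
  ring

theorem conj_kpt : conj (kpt ξ₀) = I * tanParam ξ₀ := by
  simp [kpt_eq]

theorem norm_kpt (h0 : 0 < ξ₀) (h1 : ξ₀ < π) : ‖kpt ξ₀‖ = tanParam ξ₀ := by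
  simp [kpt_eq, abs_of_pos (tanParam_pos h0 h1)]

theorem bk_eq : bk ξ₀ z = (tanParam ξ₀ - I * z) / (1 - tanParam ξ₀ * (I * z)) := by
  rw [bk, conj_kpt, kpt_eq, Complex.inv_I]
  congr 1
  · linear_combination (-(tanParam ξ₀ : ℂ)) * Complex.I_mul_I
  · ring

theorem bkb_eq : bkb ξ₀ z = (tanParam ξ₀ + I * z) / (1 + tanParam ξ₀ * (I * z)) := by
  rw [bkb, conj_kpt, kpt_eq]
  congr 1
  · linear_combination (-(tanParam ξ₀ : ℂ)) * Complex.I_mul_I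
  · ring

/-- The square root of `1 - |κ|²`. -/
def kerScale (ξ₀ : ℝ) : ℝ := Real.sqrt (1 - tanParam ξ₀ ^ 2)

theorem kerScale_pos (h0 : 0 < ξ₀) (h1 : ξ₀ < π) : 0 < kerScale ξ₀ :=
  Real.sqrt_pos.2 (by nlinarith [tanParam_pos h0 h1, tanParam_lt_one h0 h1])

theorem Kker_kpt (h0 : 0 < ξ₀) (h1 : ξ₀ < π) :
    Kker (kpt ξ₀) z = kerScale ξ₀ / (1 - tanParam ξ₀ * (I * z)) := by
  rw [Kker, norm_kpt h0 h1, conj_kpt, kerScale]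
  ring_nf

theorem Kker_conj_kpt (h0 : 0 < ξ₀) (h1 : ξ₀ < π) :
    Kker (conj (kpt ξ₀)) z = kerScale ξ₀ / (1 + tanParam ξ₀ * (I * z)) := by
  rw [Kker, RCLike.norm_conj, norm_kpt h0 h1, Complex.conj_conj, kpt_eq, kerScale]
  ring_nf

theorem one_sub_ne_zero (h0 : 0 < ξ₀) (h1 : ξ₀ < π) (hz : ‖z‖ ≤ 1) :
    1 - (tanParam ξ₀ : ℂ) * (I * z) ≠ 0 := by
  intro h
  have h2 : ‖(tanParam ξ₀ : ℂ) * (I * z)‖ = 1 := by rw [← sub_eq_zero.1 h, norm_one]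
  rw [norm_mul, norm_mul, norm_I, one_mul, norm_real, Real.norm_eq_abs,
    abs_of_pos (tanParam_pos h0 h1)] at h2
  nlinarith [tanParam_pos h0 h1, tanParam_lt_one h0 h1]

theorem one_add_ne_zero (h0 : 0 < ξ₀) (h1 : ξ₀ < π) (hz : ‖z‖ ≤ 1) :
    1 + (tanParam ξ₀ : ℂ) * (I * z) ≠ 0 := by
  have := one_sub_ne_zero (z := -z) h0 h1 (by simpa using hz)
  intro h
  apply this
  linear_combination h

theorem sub_I_mul_ne_zero (h0 : 0 < ξ₀) (h1 : ξ₀ < π) (hz : ‖z‖ = 1) :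
    (tanParam ξ₀ : ℂ) - I * z ≠ 0 := by
  intro h
  have h2 : ‖(tanParam ξ₀ : ℂ)‖ = 1 := by rw [sub_eq_zero.1 h, norm_mul, norm_I, hz, one_mul]
  rw [norm_real, Real.norm_eq_abs, abs_of_pos (tanParam_pos h0 h1)] at h2
  linarith [tanParam_lt_one h0 h1]

theorem add_I_mul_ne_zero (h0 : 0 < ξ₀) (h1 : ξ₀ < π) (hz : ‖z‖ = 1) :
    (tanParam ξ₀ : ℂ) + I * z ≠ 0 := by
  have := sub_I_mul_ne_zero (z := -z) h0 h1 (by simpa using hz)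
  intro h
  apply this
  linear_combination h

theorem bk_ne_zero (h0 : 0 < ξ₀) (h1 : ξ₀ < π) (hz : ‖z‖ = 1) : bk ξ₀ z ≠ 0 := by
  rw [bk_eq]
  exact div_ne_zero (sub_I_mul_ne_zero h0 h1 hz) (one_sub_ne_zero h0 h1 hz.le)

theorem bkb_ne_zero (h0 : 0 < ξ₀) (h1 : ξ₀ < π) (hz : ‖z‖ = 1) : bkb ξ₀ z ≠ 0 := by
  rw [bkb_eq]
  exact div_ne_zero (add_I_mul_ne_zero h0 h1 hz) (one_add_ne_zero h0 h1 hz.le)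

theorem conj_eq_inv (hz : ‖z‖ = 1) : conj z = z⁻¹ := (Complex.inv_eq_conj hz).symm

theorem bk_mul_conj (h0 : 0 < ξ₀) (h1 : ξ₀ < π) (hz : ‖z‖ = 1) :
    bk ξ₀ z * conj (bk ξ₀ z) = 1 := by
  have hz0 : z ≠ 0 := by rintro rfl; simp at hz
  have hn := sub_I_mul_ne_zero h0 h1 hz
  have hd := one_sub_ne_zero h0 h1 hz.le
  have hI := Complex.I_mul_I
  have e : conj (bk ξ₀ z) = (tanParam ξ₀ * z + I) / (z + I * tanParam ξ₀) := by
    rw [bk_eq]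
    simp only [map_div₀, map_sub, map_mul, conj_I, conj_ofReal, map_one, conj_eq_inv hz]
    rw [← mul_div_mul_right _ _ hz0]
    congr 1 <;> field_simp <;> ring
  have h3 : z + I * tanParam ξ₀ = I * (tanParam ξ₀ - I * z) := by
    linear_combination z * hI
  have h4 : tanParam ξ₀ * z + I = I * (1 - tanParam ξ₀ * (I * z)) := by
    linear_combination ((tanParam ξ₀ : ℂ) * z) * hI
  rw [e, h3, h4, bk_eq, mul_div_mul_left _ _ I_ne_zero, div_mul_div_cancel₀ hd, div_self hn]

theorem bkb_eq_bk_neg : bkb ξ₀ z = bk ξ₀ (-z) := by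
  rw [bkb_eq, bk_eq]
  ring_nf

theorem bkb_mul_conj (h0 : 0 < ξ₀) (h1 : ξ₀ < π) (hz : ‖z‖ = 1) :
    bkb ξ₀ z * conj (bkb ξ₀ z) = 1 := by
  rw [bkb_eq_bk_neg]
  exact bk_mul_conj h0 h1 (by simpa using hz)

end Factors

section Recurrences

variable {ξ₀ : ℝ} {z : ℂ}

/-- The constant Verblunsky coefficient. -/
def verb (ξ₀ c : ℝ) : ℂ := Complex.exp (c * I) * (Real.sin (ξ₀ / 2) : ℝ)

theorem rho_verb (h0 : 0 < ξ₀) (h1 : ξ₀ < π) (c : ℝ) :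
    rho (verb ξ₀ c) = (Real.cos (ξ₀ / 2) : ℝ) := by
  have hs : ‖verb ξ₀ c‖ ^ 2 = Real.sin (ξ₀ / 2) ^ 2 := by
    rw [verb, norm_mul, norm_exp_ofReal_mul_I, one_mul, norm_real, Real.norm_eq_abs, sq_abs]
  have hc : 0 < Real.cos (ξ₀ / 2) := Real.cos_pos_of_mem_Ioo ⟨by linarith, by linarith⟩
  rw [rho, hs, ← Real.cos_sq', Real.sqrt_sq hc.le]

theorem conj_exp_mul_I (c : ℝ) : conj (Complex.exp (c * I)) = (Complex.exp (c * I))⁻¹ := by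
  rw [← Complex.exp_conj, ← Complex.exp_neg]
  simp

theorem conj_verb (ξ₀ c : ℝ) :
    conj (verb ξ₀ c) = (Complex.exp (c * I))⁻¹ * (Real.sin (ξ₀ / 2) : ℝ) := by
  rw [verb, map_mul, conj_exp_mul_I, conj_ofReal]

theorem conj_verb_mul (ξ₀ c : ℝ) :
    conj (verb ξ₀ c) * verb ξ₀ c = ((Real.sin (ξ₀ / 2) : ℝ) : ℂ) ^ 2 := by
  rw [conj_verb, verb]
  field_simp [Complex.exp_ne_zero]

theorem rho_verb_sq (h0 : 0 < ξ₀) (h1 : ξ₀ < π) (c : ℝ) :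
    rho (verb ξ₀ c) ^ 2 = 1 - conj (verb ξ₀ c) * verb ξ₀ c := by
  rw [conj_verb_mul, rho_verb h0 h1, eq_sub_iff_add_eq]
  exact_mod_cast Real.cos_sq_add_sin_sq (ξ₀ / 2)

theorem freeSys_even (ξ₀ c : ℝ) (m : ℤ) (z : ℂ) :
    freeSys ξ₀ c (2 * m) z =
      bk ξ₀ z ^ m * bkb ξ₀ z ^ m * (Kker (conj (kpt ξ₀)) z * Complex.exp (c * I)) := by
  rw [freeSys, if_pos (even_two_mul m), Int.mul_ediv_cancel_left _ two_ne_zero, mul_assoc]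

theorem freeSys_odd (h0 : 0 < ξ₀) (h1 : ξ₀ < π) (c : ℝ) (m : ℤ) (hz : ‖z‖ = 1) :
    freeSys ξ₀ c (2 * m + 1) z =
      bk ξ₀ z ^ m * bkb ξ₀ z ^ m * (bkb ξ₀ z * Kker (kpt ξ₀) z) := by
  rw [freeSys, if_neg (by simp), show (2 * m + 1 - 1) / 2 = m by omega,
    show (2 * m + 1 + 1) / 2 = m + 1 by omega, zpow_add_one₀ (bkb_ne_zero h0 h1 hz)]
  ring

theorem bk_mul_freeSys_even (h0 : 0 < ξ₀) (h1 : ξ₀ < π) (c : ℝ) (m : ℤ) (hz : ‖z‖ = 1) :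
    bk ξ₀ z * freeSys ξ₀ c (2 * m) z =
      rho (verb ξ₀ c) * freeSys ξ₀ c (2 * m) z - verb ξ₀ c * freeSys ξ₀ c (2 * m + 1) z := by
  have key : bk ξ₀ z * (Kker (conj (kpt ξ₀)) z * Complex.exp (c * I)) =
      rho (verb ξ₀ c) * (Kker (conj (kpt ξ₀)) z * Complex.exp (c * I)) -
        verb ξ₀ c * (bkb ξ₀ z * Kker (kpt ξ₀) z) := by
    have hd := one_sub_ne_zero h0 h1 hz.le
    have hd' := one_add_ne_zero h0 h1 hz.le
    have ht : (1 : ℂ) + (tanParam ξ₀ : ℂ) ^ 2 ≠ 0 := by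
      exact_mod_cast (by positivity : (0 : ℝ) < 1 + tanParam ξ₀ ^ 2).ne'
    rw [rho_verb h0 h1, verb, sin_half_eq h0 h1, cos_half_eq h0 h1, bk_eq, bkb_eq,
      Kker_kpt h0 h1, Kker_conj_kpt h0 h1]
    push_cast
    generalize I * z = u at *
    generalize (tanParam ξ₀ : ℂ) = t at *
    field_simp
    ring
  rw [freeSys_even, freeSys_odd h0 h1 c m hz]
  linear_combination (bk ξ₀ z ^ m * bkb ξ₀ z ^ m) * key

theorem bk_mul_freeSys_odd (h0 : 0 < ξ₀) (h1 : ξ₀ < π) (c : ℝ) (m : ℤ) (hz : ‖z‖ = 1) :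
    bk ξ₀ z * freeSys ξ₀ c (2 * m + 1) z =
      conj (verb ξ₀ c) * freeSys ξ₀ c (2 * (m + 1)) z +
        rho (verb ξ₀ c) * freeSys ξ₀ c (2 * (m + 1) + 1) z := by
  have key : Kker (kpt ξ₀) z =
      conj (verb ξ₀ c) * (Kker (conj (kpt ξ₀)) z * Complex.exp (c * I)) +
        rho (verb ξ₀ c) * (bkb ξ₀ z * Kker (kpt ξ₀) z) := by
    have hd := one_sub_ne_zero h0 h1 hz.le
    have hd' := one_add_ne_zero h0 h1 hz.le
    have ht : (1 : ℂ) + (tanParam ξ₀ : ℂ) ^ 2 ≠ 0 := by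
      exact_mod_cast (by positivity : (0 : ℝ) < 1 + tanParam ξ₀ ^ 2).ne'
    have hE := Complex.exp_ne_zero (c * I)
    rw [rho_verb h0 h1, conj_verb, sin_half_eq h0 h1, cos_half_eq h0 h1, bkb_eq,
      Kker_kpt h0 h1, Kker_conj_kpt h0 h1]
    push_cast
    generalize I * z = u at *
    generalize (tanParam ξ₀ : ℂ) = t at *
    field_simp
    ring
  rw [freeSys_even, freeSys_odd h0 h1 c _ hz, freeSys_odd h0 h1 c _ hz,
    zpow_add_one₀ (bk_ne_zero h0 h1 hz), zpow_add_one₀ (bkb_ne_zero h0 h1 hz)]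
  linear_combination (bk ξ₀ z ^ m * bkb ξ₀ z ^ m * bk ξ₀ z * bkb ξ₀ z) * key

theorem freeSys_add_two (h0 : 0 < ξ₀) (h1 : ξ₀ < π) (c : ℝ) (n : ℤ) (hz : ‖z‖ = 1) :
    freeSys ξ₀ c (n + 2) z = bk ξ₀ z * bkb ξ₀ z * freeSys ξ₀ c n z := by
  obtain ⟨m, rfl | rfl⟩ := n.even_or_odd'
  · rw [show 2 * m + 2 = 2 * (m + 1) by ring, freeSys_even, freeSys_even,
      zpow_add_one₀ (bk_ne_zero h0 h1 hz), zpow_add_one₀ (bkb_ne_zero h0 h1 hz)]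
    ring
  · rw [show 2 * m + 1 + 2 = 2 * (m + 1) + 1 by ring, freeSys_odd h0 h1 c _ hz,
      freeSys_odd h0 h1 c _ hz, zpow_add_one₀ (bk_ne_zero h0 h1 hz),
      zpow_add_one₀ (bkb_ne_zero h0 h1 hz)]
    ring

theorem vmap_mul_freeSys (h0 : 0 < ξ₀) (h1 : ξ₀ < π) (c : ℝ) (n : ℤ) (hz : ‖z‖ = 1) :
    vmap ξ₀ z * freeSys ξ₀ c (n + 2) z = bk ξ₀ z * (bk ξ₀ z * freeSys ξ₀ c n z) := by
  rw [vmap, freeSys_add_two h0 h1 c n hz]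
  field_simp [bkb_ne_zero h0 h1 hz]

theorem vmap_mul_freeSys_even (h0 : 0 < ξ₀) (h1 : ξ₀ < π) (c : ℝ) (m : ℤ) (hz : ‖z‖ = 1) :
    vmap ξ₀ z * freeSys ξ₀ c (2 * m) z =
      rho (verb ξ₀ c) ^ 2 * freeSys ξ₀ c (2 * m - 2) z +
        -(rho (verb ξ₀ c) * verb ξ₀ c) * freeSys ξ₀ c (2 * m - 1) z +
        -(conj (verb ξ₀ c) * verb ξ₀ c) * freeSys ξ₀ c (2 * m) z +
        -(rho (verb ξ₀ c) * verb ξ₀ c) * freeSys ξ₀ c (2 * m + 1) z := by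
  have h := vmap_mul_freeSys h0 h1 c (2 * (m - 1)) hz
  have he := bk_mul_freeSys_even h0 h1 c (m - 1) hz
  have ho := bk_mul_freeSys_odd h0 h1 c (m - 1) hz
  rw [sub_add_cancel] at ho
  rw [show 2 * (m - 1) + 2 = 2 * m by ring] at h
  rw [show 2 * m - 2 = 2 * (m - 1) by ring, show 2 * m - 1 = 2 * (m - 1) + 1 by ring]
  linear_combination h + (bk ξ₀ z + rho (verb ξ₀ c)) * he - verb ξ₀ c * ho

theorem vmap_mul_freeSys_odd (h0 : 0 < ξ₀) (h1 : ξ₀ < π) (c : ℝ) (m : ℤ) (hz : ‖z‖ = 1) :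
    vmap ξ₀ z * freeSys ξ₀ c (2 * m + 1) z =
      conj (verb ξ₀ c) * rho (verb ξ₀ c) * freeSys ξ₀ c (2 * m) z +
        -(conj (verb ξ₀ c) * verb ξ₀ c) * freeSys ξ₀ c (2 * m + 1) z +
        conj (verb ξ₀ c) * rho (verb ξ₀ c) * freeSys ξ₀ c (2 * m + 2) z +
        rho (verb ξ₀ c) ^ 2 * freeSys ξ₀ c (2 * m + 3) z := by
  have h := vmap_mul_freeSys h0 h1 c (2 * (m - 1) + 1) hz
  have he := bk_mul_freeSys_even h0 h1 c m hz
  have ho := bk_mul_freeSys_odd h0 h1 c (m - 1) hz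
  have ho' := bk_mul_freeSys_odd h0 h1 c m hz
  rw [sub_add_cancel] at ho
  rw [show 2 * (m - 1) + 1 + 2 = 2 * m + 1 by ring] at h
  rw [show 2 * m + 2 = 2 * (m + 1) by ring, show 2 * m + 3 = 2 * (m + 1) + 1 by ring]
  linear_combination h + bk ξ₀ z * ho + conj (verb ξ₀ c) * he + rho (verb ξ₀ c) * ho'

theorem conj_bk_mul_freeSys_even (h0 : 0 < ξ₀) (h1 : ξ₀ < π) (c : ℝ) (m : ℤ) (hz : ‖z‖ = 1) :
    conj (bk ξ₀ z) * freeSys ξ₀ c (2 * m) z =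
      verb ξ₀ c * freeSys ξ₀ c (2 * (m - 1) + 1) z + rho (verb ξ₀ c) * freeSys ξ₀ c (2 * m) z := by
  have he := bk_mul_freeSys_even h0 h1 c m hz
  have ho := bk_mul_freeSys_odd h0 h1 c (m - 1) hz
  have hr := rho_verb_sq h0 h1 c
  have hb := bk_mul_conj h0 h1 hz
  rw [sub_add_cancel] at ho
  linear_combination
    (-conj (bk ξ₀ z)) * (verb ξ₀ c * ho + rho (verb ξ₀ c) * he) +
    hb * (verb ξ₀ c * freeSys ξ₀ c (2 * (m - 1) + 1) z + rho (verb ξ₀ c) * freeSys ξ₀ c (2 * m) z)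
    - conj (bk ξ₀ z) * freeSys ξ₀ c (2 * m) z * hr

theorem conj_bk_mul_freeSys_odd (h0 : 0 < ξ₀) (h1 : ξ₀ < π) (c : ℝ) (m : ℤ) (hz : ‖z‖ = 1) :
    conj (bk ξ₀ z) * freeSys ξ₀ c (2 * m + 1) z =
      rho (verb ξ₀ c) * freeSys ξ₀ c (2 * (m - 1) + 1) z -
        conj (verb ξ₀ c) * freeSys ξ₀ c (2 * m) z := by
  have he := bk_mul_freeSys_even h0 h1 c m hz
  have ho := bk_mul_freeSys_odd h0 h1 c (m - 1) hz
  have hr := rho_verb_sq h0 h1 c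
  have hb := bk_mul_conj h0 h1 hz
  rw [sub_add_cancel] at ho
  linear_combination
    (-conj (bk ξ₀ z)) * (rho (verb ξ₀ c) * ho - conj (verb ξ₀ c) * he) +
    hb * (rho (verb ξ₀ c) * freeSys ξ₀ c (2 * (m - 1) + 1) z -
      conj (verb ξ₀ c) * freeSys ξ₀ c (2 * m) z)
    - conj (bk ξ₀ z) * freeSys ξ₀ c (2 * m + 1) z * hr

end Recurrences

section CircleIntegrals

theorem norm_circPt (θ : ℝ) : ‖circPt θ‖ = 1 := norm_exp_ofReal_mul_I θ

theorem continuous_circPt : Continuous circPt := by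
  unfold circPt
  fun_prop

theorem circleMap_eq_circPt (θ : ℝ) : circleMap 0 1 θ = circPt θ := by
  simp [circleMap, circPt]

theorem two_pi_cast_ne_zero : ((2 * π : ℝ) : ℂ) ≠ 0 :=
  ofReal_ne_zero.2 Real.two_pi_pos.ne'

theorem mInt_congr {f g : ℂ → ℂ} (h : ∀ z, ‖z‖ = 1 → f z = g z) : mInt f = mInt g := by
  unfold mInt
  simp_rw [fun θ => h _ (norm_circPt θ)]

theorem mInt_conj (f : ℂ → ℂ) : mInt (fun z => conj (f z)) = conj (mInt f) := by
  simp only [mInt, map_mul, map_inv₀, conj_ofReal]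
  rw [intervalIntegral.integral_of_le Real.two_pi_pos.le,
    intervalIntegral.integral_of_le Real.two_pi_pos.le, integral_conj]

theorem mInt_const_mul (a : ℂ) (f : ℂ → ℂ) : mInt (fun z => a * f z) = a * mInt f := by
  simp only [mInt, intervalIntegral.integral_const_mul]
  ring

theorem continuous_comp_circPt {f : ℂ → ℂ} (hf : ContinuousOn f (Metric.sphere 0 1)) :
    Continuous fun θ => f (circPt θ) :=
  hf.comp_continuous continuous_circPt fun θ => by simp [norm_circPt]

theorem mInt_add {f g : ℂ → ℂ} (hf : ContinuousOn f (Metric.sphere 0 1))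
    (hg : ContinuousOn g (Metric.sphere 0 1)) :
    mInt (fun z => f z + g z) = mInt f + mInt g := by
  simp only [mInt]
  rw [intervalIntegral.integral_add ((continuous_comp_circPt hf).intervalIntegrable _ _)
    ((continuous_comp_circPt hg).intervalIntegrable _ _), mul_add]

theorem mInt_id_mul {f : ℂ → ℂ} (hf : DiffContOnCl ℂ f (Metric.ball 0 1)) :
    mInt (fun z => z * f z) = 0 := by
  have h := hf.circleIntegral_eq_zero zero_le_one
  simp only [circleIntegral, deriv_circleMap, circleMap_eq_circPt, smul_eq_mul] at h
  simp_rw [mul_comm _ I, mul_assoc] at h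
  rw [intervalIntegral.integral_const_mul] at h
  rw [mInt, (mul_eq_zero.1 h).resolve_left I_ne_zero, mul_zero]

theorem mInt_mul_conj_Kker {f : ℂ → ℂ} (hf : DiffContOnCl ℂ f (Metric.ball 0 1)) {w : ℂ}
    (hw : ‖w‖ < 1) :
    mInt (fun z => f z * conj (Kker w z)) = (Real.sqrt (1 - ‖w‖ ^ 2) : ℂ) * f w := by
  have h := hf.circleIntegral_sub_inv_smul (w := w) (by simpa using hw)
  simp only [circleIntegral, deriv_circleMap, circleMap_eq_circPt, smul_eq_mul] at h
  have hcongr : ∀ z : ℂ, ‖z‖ = 1 → f z * conj (Kker w z) =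
      ((Real.sqrt (1 - ‖w‖ ^ 2) : ℂ) * I⁻¹) * (z * I * ((z - w)⁻¹ * f z)) := by
    intro z hz
    have hz0 : z ≠ 0 := by rintro rfl; simp at hz
    have hzw : z - w ≠ 0 := by
      intro h0
      rw [← sub_eq_zero.1 h0, hz] at hw
      exact lt_irrefl _ hw
    rw [Kker]
    simp only [map_div₀, map_sub, map_mul, map_one, Complex.conj_conj, conj_ofReal, conj_eq_inv hz]
    have : 1 - z⁻¹ * w = (z - w) / z := by field_simp
    rw [this]
    field_simp [I_ne_zero]
  rw [mInt_congr hcongr, mInt_const_mul, mInt, h]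
  have := two_pi_cast_ne_zero
  push_cast at this ⊢
  field_simp [I_ne_zero]

end CircleIntegrals

section Orthonormality

variable {ξ₀ : ℝ} {z : ℂ}

theorem norm_kpt_lt_one (h0 : 0 < ξ₀) (h1 : ξ₀ < π) : ‖kpt ξ₀‖ < 1 := by
  rw [norm_kpt h0 h1]
  exact tanParam_lt_one h0 h1

theorem differentiableAt_bk (h0 : 0 < ξ₀) (h1 : ξ₀ < π) (hz : ‖z‖ ≤ 1) :
    DifferentiableAt ℂ (bk ξ₀) z := by
  rw [funext fun z => bk_eq (ξ₀ := ξ₀) (z := z)]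
  exact DifferentiableAt.div (by fun_prop) (by fun_prop) (one_sub_ne_zero h0 h1 hz)

theorem differentiableAt_bkb (h0 : 0 < ξ₀) (h1 : ξ₀ < π) (hz : ‖z‖ ≤ 1) :
    DifferentiableAt ℂ (bkb ξ₀) z := by
  rw [funext fun z => bkb_eq (ξ₀ := ξ₀) (z := z)]
  exact DifferentiableAt.div (by fun_prop) (by fun_prop) (one_add_ne_zero h0 h1 hz)

theorem differentiableAt_Kker_kpt (h0 : 0 < ξ₀) (h1 : ξ₀ < π) (hz : ‖z‖ ≤ 1) :
    DifferentiableAt ℂ (Kker (kpt ξ₀)) z := by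
  rw [show Kker (kpt ξ₀) = _ from funext fun z => Kker_kpt h0 h1 (z := z)]
  exact DifferentiableAt.div (by fun_prop) (by fun_prop) (one_sub_ne_zero h0 h1 hz)

theorem differentiableAt_Kker_conj_kpt (h0 : 0 < ξ₀) (h1 : ξ₀ < π) (hz : ‖z‖ ≤ 1) :
    DifferentiableAt ℂ (Kker (conj (kpt ξ₀))) z := by
  rw [show Kker (conj (kpt ξ₀)) = _ from funext fun z => Kker_conj_kpt h0 h1 (z := z)]
  exact DifferentiableAt.div (by fun_prop) (by fun_prop) (one_add_ne_zero h0 h1 hz)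

theorem continuousOn_sphere_of_differentiableAt {f : ℂ → ℂ}
    (hf : ∀ z, ‖z‖ ≤ 1 → DifferentiableAt ℂ f z) : ContinuousOn f (Metric.sphere 0 1) :=
  fun z hz => (hf z (mem_sphere_zero_iff_norm.1 hz).le).continuousAt.continuousWithinAt

theorem diffContOnCl_of_differentiableAt {f : ℂ → ℂ}
    (hf : ∀ z, ‖z‖ ≤ 1 → DifferentiableAt ℂ f z) : DiffContOnCl ℂ f (Metric.ball 0 1) := by
  apply DifferentiableOn.diffContOnCl
  rw [closure_ball _ one_ne_zero]
  exact fun z hz => (hf z (by simpa using hz)).differentiableWithinAt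

theorem continuousOn_bk (h0 : 0 < ξ₀) (h1 : ξ₀ < π) :
    ContinuousOn (bk ξ₀) (Metric.sphere 0 1) :=
  continuousOn_sphere_of_differentiableAt fun _ => differentiableAt_bk h0 h1

theorem continuousOn_bkb (h0 : 0 < ξ₀) (h1 : ξ₀ < π) :
    ContinuousOn (bkb ξ₀) (Metric.sphere 0 1) :=
  continuousOn_sphere_of_differentiableAt fun _ => differentiableAt_bkb h0 h1

theorem continuousOn_freeSys (h0 : 0 < ξ₀) (h1 : ξ₀ < π) (c : ℝ) (n : ℤ) :
    ContinuousOn (freeSys ξ₀ c n) (Metric.sphere 0 1) := by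
  have hb (m : ℤ) : ContinuousOn (fun z => bk ξ₀ z ^ m) (Metric.sphere 0 1) :=
    (continuousOn_bk h0 h1).zpow₀ _ fun z hz =>
      Or.inl (bk_ne_zero h0 h1 (mem_sphere_zero_iff_norm.1 hz))
  have hbb (m : ℤ) : ContinuousOn (fun z => bkb ξ₀ z ^ m) (Metric.sphere 0 1) :=
    (continuousOn_bkb h0 h1).zpow₀ _ fun z hz =>
      Or.inl (bkb_ne_zero h0 h1 (mem_sphere_zero_iff_norm.1 hz))
  have hK := continuousOn_sphere_of_differentiableAt fun _ => differentiableAt_Kker_kpt h0 h1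
  have hK' := continuousOn_sphere_of_differentiableAt fun _ =>
    differentiableAt_Kker_conj_kpt h0 h1
  unfold freeSys
  split_ifs
  · exact (((hb _).mul (hbb _)).mul hK').mul continuousOn_const
  · exact ((hb _).mul (hbb _)).mul hK

theorem continuousOn_conj {f : ℂ → ℂ} {s : Set ℂ} (hf : ContinuousOn f s) :
    ContinuousOn (fun z => conj (f z)) s :=
  Complex.continuous_conj.comp_continuousOn hf

theorem bk_mul_bkb_mul_conj (h0 : 0 < ξ₀) (h1 : ξ₀ < π) (m n : ℤ) (hz : ‖z‖ = 1) :
    bk ξ₀ z ^ m * bkb ξ₀ z ^ m * conj (bk ξ₀ z ^ n * bkb ξ₀ z ^ n) =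
      (bk ξ₀ z * bkb ξ₀ z) ^ (m - n) := by
  have hb := bk_ne_zero h0 h1 hz
  have hb' := bkb_ne_zero h0 h1 hz
  rw [map_mul, map_zpow₀, map_zpow₀, eq_inv_of_mul_eq_one_right (bk_mul_conj h0 h1 hz),
    eq_inv_of_mul_eq_one_right (bkb_mul_conj h0 h1 hz), inv_zpow, inv_zpow, ← mul_zpow,
    ← mul_inv, ← mul_zpow, zpow_sub₀ (mul_ne_zero hb hb'), div_eq_mul_inv]

theorem bk_kpt : bk ξ₀ (kpt ξ₀) = 0 := by simp [bk]

theorem bkb_conj_kpt : bkb ξ₀ (conj (kpt ξ₀)) = 0 := by simp [bkb]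

theorem sqrt_mul_Kker_self {w : ℂ} (hw : ‖w‖ < 1) :
    (Real.sqrt (1 - ‖w‖ ^ 2) : ℂ) * Kker w w = 1 := by
  have hpos : 0 < 1 - ‖w‖ ^ 2 := by nlinarith [norm_nonneg w]
  have hs : (Real.sqrt (1 - ‖w‖ ^ 2) : ℂ) * Real.sqrt (1 - ‖w‖ ^ 2) = 1 - w * conj w := by
    rw [← ofReal_mul, Real.mul_self_sqrt hpos.le, Complex.mul_conj']
    push_cast
    rfl
  have hne : 1 - w * conj w ≠ 0 := by
    rw [← hs]
    exact mul_self_ne_zero.2 (ofReal_ne_zero.2 (Real.sqrt_pos.2 hpos).ne')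
  rw [Kker, mul_div_assoc', hs, div_self hne]

theorem mInt_freeSys_of_le (h0 : 0 < ξ₀) (h1 : ξ₀ < π) (c : ℝ) {m n : ℤ} (hmn : m ≤ n) :
    mInt (fun z => freeSys ξ₀ c n z * conj (freeSys ξ₀ c m z)) = if m = n then 1 else 0 := by
  have hκ := norm_kpt_lt_one h0 h1
  have hκ' : ‖conj (kpt ξ₀)‖ < 1 := by rwa [RCLike.norm_conj]
  have hE : Complex.exp (c * I) * conj (Complex.exp (c * I)) = 1 := by
    rw [conj_exp_mul_I, mul_inv_cancel₀ (Complex.exp_ne_zero _)]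
  obtain ⟨q, rfl | rfl⟩ := m.even_or_odd' <;> obtain ⟨p, rfl | rfl⟩ := n.even_or_odd'
  · obtain ⟨k, hk⟩ := Int.eq_ofNat_of_zero_le (show 0 ≤ p - q by omega)
    have hcongr : ∀ z : ℂ, ‖z‖ = 1 →
        freeSys ξ₀ c (2 * p) z * conj (freeSys ξ₀ c (2 * q) z) =
          ((bk ξ₀ z * bkb ξ₀ z) ^ k * Kker (conj (kpt ξ₀)) z) *
            conj (Kker (conj (kpt ξ₀)) z) := by
      intro z hz
      have hB := bk_mul_bkb_mul_conj h0 h1 p q hz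
      rw [hk, zpow_natCast] at hB
      rw [freeSys_even, freeSys_even, map_mul, map_mul _ (Kker _ _), ← hB]
      linear_combination (bk ξ₀ z ^ p * bkb ξ₀ z ^ p * conj (bk ξ₀ z ^ q * bkb ξ₀ z ^ q) *
        Kker (conj (kpt ξ₀)) z * conj (Kker (conj (kpt ξ₀)) z)) * hE
    rw [mInt_congr hcongr, mInt_mul_conj_Kker (diffContOnCl_of_differentiableAt fun z hz =>
      (((differentiableAt_bk h0 h1 hz).fun_mul (differentiableAt_bkb h0 h1 hz)).fun_pow k).fun_mul
        (differentiableAt_Kker_conj_kpt h0 h1 hz)) hκ', bkb_conj_kpt]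
    obtain rfl | hk0 := eq_or_ne k 0
    · rw [if_pos (by omega), pow_zero, one_mul, sqrt_mul_Kker_self hκ']
    · rw [if_neg (by omega), mul_zero, zero_pow hk0, zero_mul, mul_zero]
  · obtain ⟨k, hk⟩ := Int.eq_ofNat_of_zero_le (show 0 ≤ p - q by omega)
    have hcongr : ∀ z : ℂ, ‖z‖ = 1 →
        freeSys ξ₀ c (2 * p + 1) z * conj (freeSys ξ₀ c (2 * q) z) =
          conj (Complex.exp (c * I)) *
            (((bk ξ₀ z * bkb ξ₀ z) ^ k * (bkb ξ₀ z * Kker (kpt ξ₀) z)) *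
              conj (Kker (conj (kpt ξ₀)) z)) := by
      intro z hz
      have hB := bk_mul_bkb_mul_conj h0 h1 p q hz
      rw [hk, zpow_natCast] at hB
      rw [freeSys_even, freeSys_odd h0 h1 c p hz, map_mul, map_mul _ (Kker _ _), ← hB]
      ring
    rw [mInt_congr hcongr, mInt_const_mul, mInt_mul_conj_Kker
      (diffContOnCl_of_differentiableAt fun z hz =>
      (((differentiableAt_bk h0 h1 hz).fun_mul (differentiableAt_bkb h0 h1 hz)).fun_pow k).fun_mul
        ((differentiableAt_bkb h0 h1 hz).fun_mul (differentiableAt_Kker_kpt h0 h1 hz))) hκ',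
      bkb_conj_kpt, if_neg (by omega)]
    ring
  · obtain ⟨k, hk⟩ := Int.eq_ofNat_of_zero_le (show 0 ≤ p - q - 1 by omega)
    have hcongr : ∀ z : ℂ, ‖z‖ = 1 →
        freeSys ξ₀ c (2 * p) z * conj (freeSys ξ₀ c (2 * q + 1) z) =
          Complex.exp (c * I) *
            (((bk ξ₀ z * bkb ξ₀ z) ^ k * (bk ξ₀ z * Kker (conj (kpt ξ₀)) z)) *
              conj (Kker (kpt ξ₀) z)) := by
      intro z hz
      have hB := bk_mul_bkb_mul_conj h0 h1 p q hz
      rw [show p - q = k + 1 by omega, zpow_add_one₀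
        (mul_ne_zero (bk_ne_zero h0 h1 hz) (bkb_ne_zero h0 h1 hz)), zpow_natCast] at hB
      rw [freeSys_even, freeSys_odd h0 h1 c q hz, map_mul, map_mul _ (bkb _ _)]
      linear_combination (Kker (conj (kpt ξ₀)) z * Complex.exp (c * I) * conj (bkb ξ₀ z) *
        conj (Kker (kpt ξ₀) z)) * hB + ((bk ξ₀ z * bkb ξ₀ z) ^ k * bk ξ₀ z *
        Kker (conj (kpt ξ₀)) z * Complex.exp (c * I) * conj (Kker (kpt ξ₀) z)) *
        bkb_mul_conj h0 h1 hz
    rw [mInt_congr hcongr, mInt_const_mul, mInt_mul_conj_Kker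
      (diffContOnCl_of_differentiableAt fun z hz =>
      (((differentiableAt_bk h0 h1 hz).fun_mul (differentiableAt_bkb h0 h1 hz)).fun_pow k).fun_mul
        ((differentiableAt_bk h0 h1 hz).fun_mul (differentiableAt_Kker_conj_kpt h0 h1 hz))) hκ,
      bk_kpt, if_neg (by omega)]
    ring
  · obtain ⟨k, hk⟩ := Int.eq_ofNat_of_zero_le (show 0 ≤ p - q by omega)
    have hcongr : ∀ z : ℂ, ‖z‖ = 1 →
        freeSys ξ₀ c (2 * p + 1) z * conj (freeSys ξ₀ c (2 * q + 1) z) =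
          ((bk ξ₀ z * bkb ξ₀ z) ^ k * Kker (kpt ξ₀) z) * conj (Kker (kpt ξ₀) z) := by
      intro z hz
      have hB := bk_mul_bkb_mul_conj h0 h1 p q hz
      rw [hk, zpow_natCast] at hB
      rw [freeSys_odd h0 h1 c p hz, freeSys_odd h0 h1 c q hz, map_mul, map_mul _ (bkb _ _), ← hB]
      linear_combination (bk ξ₀ z ^ p * bkb ξ₀ z ^ p * conj (bk ξ₀ z ^ q * bkb ξ₀ z ^ q) *
        Kker (kpt ξ₀) z * conj (Kker (kpt ξ₀) z)) * bkb_mul_conj h0 h1 hz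
    rw [mInt_congr hcongr, mInt_mul_conj_Kker (diffContOnCl_of_differentiableAt fun z hz =>
      (((differentiableAt_bk h0 h1 hz).fun_mul (differentiableAt_bkb h0 h1 hz)).fun_pow k).fun_mul
        (differentiableAt_Kker_kpt h0 h1 hz)) hκ, bk_kpt]
    obtain rfl | hk0 := eq_or_ne k 0
    · rw [if_pos (by omega), pow_zero, one_mul, sqrt_mul_Kker_self hκ]
    · rw [if_neg (by omega), zero_mul, zero_pow hk0, zero_mul, mul_zero]

theorem mInt_freeSys (h0 : 0 < ξ₀) (h1 : ξ₀ < π) (c : ℝ) (m n : ℤ) :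
    mInt (fun z => freeSys ξ₀ c n z * conj (freeSys ξ₀ c m z)) = if m = n then 1 else 0 := by
  obtain h | h := le_total m n
  · exact mInt_freeSys_of_le h0 h1 c h
  · have h2 := congrArg conj (mInt_freeSys_of_le h0 h1 c h)
    rw [← mInt_conj] at h2
    simp only [map_mul, Complex.conj_conj] at h2
    simp_rw [mul_comm (freeSys ξ₀ c n _)]
    rw [h2]
    simp [apply_ite, eq_comm]

theorem memH2_freeSys (h0 : 0 < ξ₀) (h1 : ξ₀ < π) (c : ℝ) {n : ℤ} (hn : 0 ≤ n) :
    MemH2 (freeSys ξ₀ c n) := by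
  have hcont := continuous_comp_circPt (continuousOn_freeSys h0 h1 c n)
  refine ⟨hcont.measurable, (hcont.norm.pow 2).intervalIntegrable _ _, fun k hk => ?_⟩
  obtain ⟨k, rfl⟩ := Nat.exists_eq_succ_of_ne_zero hk.ne'
  obtain ⟨m, rfl⟩ := Int.eq_ofNat_of_zero_le hn
  suffices hd : ∀ z, ‖z‖ ≤ 1 → DifferentiableAt ℂ (freeSys ξ₀ c m) z by
    rw [← mInt_id_mul (f := fun z => freeSys ξ₀ c m z * z ^ k)
      (diffContOnCl_of_differentiableAt fun z hz => (hd z hz).mul (by fun_prop))]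
    exact mInt_congr fun z _ => by rw [Nat.succ_eq_add_one, pow_succ]; ring
  intro z hz
  obtain ⟨p, rfl | rfl⟩ := m.even_or_odd'
  · have : freeSys ξ₀ c (2 * p : ℕ) = fun z =>
        bk ξ₀ z ^ p * bkb ξ₀ z ^ p * (Kker (conj (kpt ξ₀)) z * Complex.exp (c * I)) := by
      funext z
      rw [Nat.cast_mul, Nat.cast_two, freeSys_even, zpow_natCast, zpow_natCast]
    rw [this]
    exact (((differentiableAt_bk h0 h1 hz).pow p).mul ((differentiableAt_bkb h0 h1 hz).pow p)).mul
      ((differentiableAt_Kker_conj_kpt h0 h1 hz).mul_const _)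
  · have : freeSys ξ₀ c (2 * p + 1 : ℕ) = fun z =>
        bk ξ₀ z ^ p * bkb ξ₀ z ^ (p + 1) * Kker (kpt ξ₀) z := by
      funext z
      rw [freeSys, if_neg (by simp), show (((2 * p + 1 : ℕ) : ℤ) - 1) / 2 = p by omega,
        show (((2 * p + 1 : ℕ) : ℤ) + 1) / 2 = (p + 1 : ℕ) by omega, zpow_natCast, zpow_natCast]
    rw [this]
    exact (((differentiableAt_bk h0 h1 hz).pow p).mul
      ((differentiableAt_bkb h0 h1 hz).pow (p + 1))).mul (differentiableAt_Kker_kpt h0 h1 hz)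

theorem mInt_linearCombination_freeSys (h0 : 0 < ξ₀) (h1 : ξ₀ < π) (c : ℝ) (m : ℤ)
    (a₁ a₂ a₃ a₄ : ℂ) (n₁ n₂ n₃ n₄ : ℤ) :
    mInt (fun z => (a₁ * freeSys ξ₀ c n₁ z + a₂ * freeSys ξ₀ c n₂ z + a₃ * freeSys ξ₀ c n₃ z +
        a₄ * freeSys ξ₀ c n₄ z) * conj (freeSys ξ₀ c m z)) =
      a₁ * (if m = n₁ then 1 else 0) + a₂ * (if m = n₂ then 1 else 0) +
        a₃ * (if m = n₃ then 1 else 0) + a₄ * (if m = n₄ then 1 else 0) := by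
  have hc (a : ℂ) (n : ℤ) : ContinuousOn
      (fun z => a * (freeSys ξ₀ c n z * conj (freeSys ξ₀ c m z))) (Metric.sphere 0 1) :=
    continuousOn_const.mul
      ((continuousOn_freeSys h0 h1 c n).mul (continuousOn_conj (continuousOn_freeSys h0 h1 c m)))
  simp_rw [add_mul, mul_assoc]
  rw [mInt_add (((hc _ _).fun_add (hc _ _)).fun_add (hc _ _)) (hc _ _),
    mInt_add ((hc _ _).fun_add (hc _ _)) (hc _ _), mInt_add (hc _ _) (hc _ _)]
  simp_rw [mInt_const_mul, mInt_freeSys h0 h1]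

theorem mInt_vmap_freeSys (h0 : 0 < ξ₀) (h1 : ξ₀ < π) (c : ℝ) (m n : ℤ) :
    mInt (fun z => vmap ξ₀ z * freeSys ξ₀ c n z * conj (freeSys ξ₀ c m z)) =
      CMVop (fun _ => verb ξ₀ c) (deltaVec n) m := by
  have hodd (q : ℤ) : ¬ Odd (2 * q) := by simp
  obtain ⟨p, rfl | rfl⟩ := n.even_or_odd'
  · rw [mInt_congr fun z hz => by rw [vmap_mul_freeSys_even h0 h1 c p hz],
      mInt_linearCombination_freeSys h0 h1]
    obtain ⟨q, rfl | rfl⟩ := m.even_or_odd' <;>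
    simp [CMVop, CMV0, CMV1, deltaVec, hodd] <;>
    split_ifs <;> first | omega | ring
  · rw [mInt_congr fun z hz => by rw [vmap_mul_freeSys_odd h0 h1 c p hz],
      mInt_linearCombination_freeSys h0 h1]
    obtain ⟨q, rfl | rfl⟩ := m.even_or_odd' <;>
    simp [CMVop, CMV0, CMV1, deltaVec, hodd] <;>
    split_ifs <;> first | omega | ring

end Orthonormality

section Pairing

instance fact_two_pi_pos : Fact (0 < 2 * π) := ⟨Real.two_pi_pos⟩

/-- The restriction of a function to the unit circle, parametrized by `ℝ / 2πℤ`. -/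
def onCircle (f : ℂ → ℂ) (hf : ContinuousOn f (Metric.sphere 0 1)) :
    C(AddCircle (2 * π), ℂ) where
  toFun x := f (AddCircle.toCircle x)
  continuous_toFun := hf.comp_continuous
    (continuous_subtype_val.comp AddCircle.continuous_toCircle) fun x => by
    simp [Circle.norm_coe]

theorem onCircle_apply (f : ℂ → ℂ) (hf : ContinuousOn f (Metric.sphere 0 1))
    (x : AddCircle (2 * π)) : onCircle f hf x = f (AddCircle.toCircle x) := rfl

theorem onCircle_coe (f : ℂ → ℂ) (hf : ContinuousOn f (Metric.sphere 0 1)) (θ : ℝ) :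
    onCircle f hf θ = f (circPt θ) := by
  rw [onCircle_apply, AddCircle.toCircle_apply_mk, div_self Real.two_pi_pos.ne', one_mul,
    Circle.coe_exp, circPt]

/-- Integration against `F` over a period, as a functional on continuous functions. -/
def pairing (F : ℝ → ℂ) (hF : IntervalIntegrable F volume 0 (2 * π)) :
    C(AddCircle (2 * π), ℂ) →L[ℂ] ℂ :=
  have hc (h : C(AddCircle (2 * π), ℂ)) : Continuous fun θ : ℝ => h θ :=
    h.continuous.comp (AddCircle.continuous_mk' _)
  LinearMap.mkContinuous
    { toFun := fun h => ∫ θ in (0 : ℝ)..(2 * π), F θ * h θ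
      map_add' := fun g h => by
        simp only [ContinuousMap.add_apply, mul_add]
        exact intervalIntegral.integral_add (hF.mul_continuousOn (hc g).continuousOn)
          (hF.mul_continuousOn (hc h).continuousOn)
      map_smul' := fun a h => by
        simp only [ContinuousMap.smul_apply, smul_eq_mul, mul_left_comm _ a,
          intervalIntegral.integral_const_mul, RingHom.id_apply] }
    (∫ θ in (0 : ℝ)..(2 * π), ‖F θ‖) fun h => by
      simp only [LinearMap.coe_mk, AddHom.coe_mk]
      rw [← intervalIntegral.integral_mul_const]
      refine intervalIntegral.norm_integral_le_of_norm_le Real.two_pi_pos.le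
        (Eventually.of_forall fun θ _ => ?_) (hF.norm.mul_const _)
      rw [norm_mul]
      gcongr
      exact h.norm_coe_le_norm _

theorem pairing_apply (F : ℝ → ℂ) (hF : IntervalIntegrable F volume 0 (2 * π))
    (h : C(AddCircle (2 * π), ℂ)) :
    pairing F hF h = ∫ θ in (0 : ℝ)..(2 * π), F θ * h θ := rfl

theorem ae_eq_zero_of_pairing_eq_zero {F : ℝ → ℂ} (hF : IntervalIntegrable F volume 0 (2 * π))
    (h : ∀ g, pairing F hF g = 0) :
    ∀ᵐ θ ∂(volume.restrict (Set.Ioc (0 : ℝ) (2 * π))), F θ = 0 := by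
  have hint := (intervalIntegrable_iff_integrableOn_Ioc_of_le Real.two_pi_pos.le).1 hF
  have hU : ∀ᵐ θ, θ ∈ Set.Ioo (0 : ℝ) (2 * π) → F θ = 0 := by
    refine isOpen_Ioo.ae_eq_zero_of_integral_contDiff_smul_eq_zero
      (hint.mono_set Set.Ioo_subset_Ioc_self).locallyIntegrableOn fun g hg _ hsupp => ?_
    have hzero : ∀ x, x ∉ Set.Ioo (0 : ℝ) (2 * π) → g x = 0 := fun x hx =>
      image_eq_zero_of_notMem_tsupport fun hx' => hx (hsupp hx')
    have hcont : Continuous (AddCircle.liftIoc (2 * π) 0 fun x => (g x : ℂ)) := by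
      refine AddCircle.liftIoc_zero_continuous ?_
        (continuous_ofReal.comp hg.continuous).continuousOn
      rw [hzero 0 (by simp), hzero (2 * π) (by simp)]
    have hp := h ⟨_, hcont⟩
    rw [pairing_apply, intervalIntegral.integral_of_le Real.two_pi_pos.le] at hp
    rw [← setIntegral_eq_integral_of_forall_compl_eq_zero (s := Set.Ioc 0 (2 * π)), ← hp]
    · refine setIntegral_congr_fun measurableSet_Ioc fun x hx => ?_
      simp only [ContinuousMap.coe_mk]
      rw [AddCircle.liftIoc_coe_apply (by simpa using hx), real_smul, mul_comm]
    · intro x hx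
      rw [hzero x fun h' => hx (Set.Ioo_subset_Ioc_self h'), zero_smul]
  rw [← restrict_Ioo_eq_restrict_Ioc, ae_restrict_iff' measurableSet_Ioo]
  exact hU

theorem intervalIntegrable_of_sq {F : ℝ → ℂ} (hm : Measurable F) {a b : ℝ}
    (hsq : IntervalIntegrable (fun θ => ‖F θ‖ ^ 2) volume a b) :
    IntervalIntegrable F volume a b := by
  refine ((intervalIntegrable_const (c := (1 : ℝ))).add hsq).mono_fun
    hm.aestronglyMeasurable (Eventually.of_forall fun θ => ?_)
  simp only [Real.norm_eq_abs]
  refine le_trans ?_ (le_abs_self _)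
  nlinarith [sq_nonneg (‖F θ‖ - 1), norm_nonneg (F θ)]

theorem pairing_onCircle_eq_zero {F : ℝ → ℂ} (hF : IntervalIntegrable F volume 0 (2 * π))
    {f g : ℂ → ℂ} (hg : ContinuousOn g (Metric.sphere 0 1)) (hf : F = fun θ => f (circPt θ))
    (h : mInt (fun z => f z * g z) = 0) : pairing F hF (onCircle g hg) = 0 := by
  subst hf
  rw [mInt, mul_eq_zero, inv_eq_zero] at h
  simpa only [pairing_apply, onCircle_coe] using h.resolve_left two_pi_cast_ne_zero

end Pairing

section Completeness

variable {ξ₀ : ℝ} {z : ℂ}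

theorem bk_injOn (h0 : 0 < ξ₀) (h1 : ξ₀ < π) :
    Set.InjOn (bk ξ₀) (Metric.sphere 0 1) := by
  intro z hz w hw h
  rw [mem_sphere_zero_iff_norm] at hz hw
  rw [bk_eq, bk_eq, div_eq_div_iff (one_sub_ne_zero h0 h1 hz.le) (one_sub_ne_zero h0 h1 hw.le)]
    at h
  have ht : (1 : ℂ) - (tanParam ξ₀ : ℂ) ^ 2 ≠ 0 := by
    have h2 : (1 : ℝ) - tanParam ξ₀ ^ 2 ≠ 0 := by
      nlinarith [tanParam_pos h0 h1, tanParam_lt_one h0 h1]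
    exact_mod_cast h2
  have h3 : (1 - (tanParam ξ₀ : ℂ) ^ 2) * I * (z - w) = 0 := by linear_combination -h
  exact sub_eq_zero.1 ((mul_eq_zero.1 h3).resolve_left (mul_ne_zero ht I_ne_zero))

/-- The span of the free system in the space of continuous functions on the circle. -/
def freeSpan (h0 : 0 < ξ₀) (h1 : ξ₀ < π) (c : ℝ) : Submodule ℂ C(AddCircle (2 * π), ℂ) :=
  Submodule.span ℂ
    (Set.range fun n : ℤ => onCircle (freeSys ξ₀ c n) (continuousOn_freeSys h0 h1 c n))

theorem onCircle_freeSys_mem (h0 : 0 < ξ₀) (h1 : ξ₀ < π) (c : ℝ) (n : ℤ) :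
    onCircle (freeSys ξ₀ c n) (continuousOn_freeSys h0 h1 c n) ∈ freeSpan h0 h1 c :=
  Submodule.subset_span ⟨n, rfl⟩

theorem mul_mem_freeSpan_of_forall (h0 : 0 < ξ₀) (h1 : ξ₀ < π) (c : ℝ)
    {h g : C(AddCircle (2 * π), ℂ)}
    (hh : ∀ n, h * onCircle (freeSys ξ₀ c n) (continuousOn_freeSys h0 h1 c n) ∈
      freeSpan h0 h1 c) (hg : g ∈ freeSpan h0 h1 c) : h * g ∈ freeSpan h0 h1 c := by
  induction hg using Submodule.span_induction with
  | mem x hx =>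
    obtain ⟨n, rfl⟩ := hx
    exact hh n
  | zero => simp
  | add x y _ _ hx hy =>
    rw [mul_add]
    exact add_mem hx hy
  | smul a x _ hx =>
    rw [mul_smul_comm]
    exact Submodule.smul_mem _ a hx

theorem onCircle_bk_mul_mem (h0 : 0 < ξ₀) (h1 : ξ₀ < π) (c : ℝ)
    {g : C(AddCircle (2 * π), ℂ)} (hg : g ∈ freeSpan h0 h1 c) :
    onCircle (bk ξ₀) (continuousOn_bk h0 h1) * g ∈ freeSpan h0 h1 c := by
  refine mul_mem_freeSpan_of_forall h0 h1 c (fun n => ?_) hg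
  have he := onCircle_freeSys_mem h0 h1 c
  obtain ⟨m, rfl | rfl⟩ := n.even_or_odd'
  · convert (freeSpan h0 h1 c).sub_mem
      (Submodule.smul_mem _ (rho (verb ξ₀ c)) (he (2 * m)))
      (Submodule.smul_mem _ (verb ξ₀ c) (he (2 * m + 1))) using 1
    ext x
    exact bk_mul_freeSys_even h0 h1 c m (Circle.norm_coe _)
  · convert (freeSpan h0 h1 c).add_mem
      (Submodule.smul_mem _ (conj (verb ξ₀ c)) (he (2 * (m + 1))))
      (Submodule.smul_mem _ (rho (verb ξ₀ c)) (he (2 * (m + 1) + 1))) using 1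
    ext x
    exact bk_mul_freeSys_odd h0 h1 c m (Circle.norm_coe _)

theorem star_onCircle_bk_mul_mem (h0 : 0 < ξ₀) (h1 : ξ₀ < π) (c : ℝ)
    {g : C(AddCircle (2 * π), ℂ)} (hg : g ∈ freeSpan h0 h1 c) :
    star (onCircle (bk ξ₀) (continuousOn_bk h0 h1)) * g ∈ freeSpan h0 h1 c := by
  refine mul_mem_freeSpan_of_forall h0 h1 c (fun n => ?_) hg
  have he := onCircle_freeSys_mem h0 h1 c
  obtain ⟨m, rfl | rfl⟩ := n.even_or_odd'
  · convert (freeSpan h0 h1 c).add_mem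
      (Submodule.smul_mem _ (verb ξ₀ c) (he (2 * (m - 1) + 1)))
      (Submodule.smul_mem _ (rho (verb ξ₀ c)) (he (2 * m))) using 1
    ext x
    exact conj_bk_mul_freeSys_even h0 h1 c m (Circle.norm_coe _)
  · convert (freeSpan h0 h1 c).sub_mem
      (Submodule.smul_mem _ (rho (verb ξ₀ c)) (he (2 * (m - 1) + 1)))
      (Submodule.smul_mem _ (conj (verb ξ₀ c)) (he (2 * m))) using 1
    ext x
    exact conj_bk_mul_freeSys_odd h0 h1 c m (Circle.norm_coe _)

theorem mul_mem_freeSpan_of_mem_adjoin (h0 : 0 < ξ₀) (h1 : ξ₀ < π) (c : ℝ)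
    {h : C(AddCircle (2 * π), ℂ)}
    (hh : h ∈ StarAlgebra.adjoin ℂ {onCircle (bk ξ₀) (continuousOn_bk h0 h1)}) :
    ∀ g ∈ freeSpan h0 h1 c, h * g ∈ freeSpan h0 h1 c := by
  rw [← StarSubalgebra.mem_toSubalgebra, StarAlgebra.adjoin_toSubalgebra] at hh
  induction hh using Algebra.adjoin_induction with
  | mem x hx =>
    intro g hg
    rcases hx with hx | hx
    · rw [Set.mem_singleton_iff.1 hx]
      exact onCircle_bk_mul_mem h0 h1 c hg
    · rw [← star_star x, Set.mem_singleton_iff.1 (Set.mem_star.1 hx)]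
      exact star_onCircle_bk_mul_mem h0 h1 c hg
  | algebraMap r =>
    intro g hg
    rw [← Algebra.smul_def]
    exact Submodule.smul_mem _ r hg
  | add x y _ _ hx hy =>
    intro g hg
    rw [add_mul]
    exact add_mem (hx g hg) (hy g hg)
  | mul x y _ _ hx hy =>
    intro g hg
    rw [mul_assoc]
    exact hx _ (hy g hg)

theorem topologicalClosure_adjoin_onCircle_bk (h0 : 0 < ξ₀) (h1 : ξ₀ < π) :
    (StarAlgebra.adjoin ℂ {onCircle (bk ξ₀) (continuousOn_bk h0 h1)}).topologicalClosure = ⊤ := by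
  refine ContinuousMap.starSubalgebra_topologicalClosure_eq_top_of_separatesPoints _
    fun x y hxy => ⟨_, ⟨_, StarAlgebra.self_mem_adjoin_singleton ℂ _, rfl⟩, fun h => hxy ?_⟩
  exact AddCircle.injective_toCircle Real.two_pi_pos.ne'
    (Circle.ext (bk_injOn h0 h1 (by simp [Circle.norm_coe]) (by simp [Circle.norm_coe]) h))

theorem freeSys_zero_ne_zero (h0 : 0 < ξ₀) (h1 : ξ₀ < π) (c : ℝ) (hz : ‖z‖ = 1) :
    freeSys ξ₀ c 0 z ≠ 0 := by
  have h := freeSys_even (ξ₀ := ξ₀) (z := z) c 0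
  rw [mul_zero] at h
  rw [h, Kker_conj_kpt h0 h1]
  simpa [kerScale_pos h0 h1 |>.ne'] using one_add_ne_zero h0 h1 hz.le

theorem pairing_eq_zero_of_freeSys (h0 : 0 < ξ₀) (h1 : ξ₀ < π) (c : ℝ) {F : ℝ → ℂ}
    (hF : IntervalIntegrable F volume 0 (2 * π))
    (h : ∀ n, pairing F hF (onCircle (freeSys ξ₀ c n) (continuousOn_freeSys h0 h1 c n)) = 0)
    (g : C(AddCircle (2 * π), ℂ)) : pairing F hF g = 0 := by
  set e := onCircle (freeSys ξ₀ c 0) (continuousOn_freeSys h0 h1 c 0) with he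
  have hspan : ∀ k ∈ freeSpan h0 h1 c, pairing F hF k = 0 := by
    intro k hk
    have hle : freeSpan h0 h1 c ≤ LinearMap.ker (pairing F hF).toLinearMap :=
      Submodule.span_le.2 (by rintro _ ⟨n, rfl⟩; exact h n)
    exact hle hk
  have hmul : ∀ k : C(AddCircle (2 * π), ℂ), pairing F hF (k * e) = 0 := by
    intro k
    have hk : k ∈ closure (StarAlgebra.adjoin ℂ {onCircle (bk ξ₀) (continuousOn_bk h0 h1)} :
        Set C(AddCircle (2 * π), ℂ)) := by
      rw [← StarSubalgebra.topologicalClosure_coe, topologicalClosure_adjoin_onCircle_bk h0 h1]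
      trivial
    have hclosed : IsClosed {k : C(AddCircle (2 * π), ℂ) | pairing F hF (k * e) = 0} :=
      isClosed_eq (by fun_prop) continuous_const
    exact closure_minimal (fun k hk => hspan _ <| mul_mem_freeSpan_of_mem_adjoin h0 h1 c hk _ <|
      onCircle_freeSys_mem h0 h1 c 0) hclosed hk
  have hne (x : AddCircle (2 * π)) : e x ≠ 0 :=
    freeSys_zero_ne_zero h0 h1 c (Circle.norm_coe _)
  convert hmul (g * ⟨fun x => (e x)⁻¹, e.continuous.inv₀ hne⟩) using 2
  ext x
  simp [hne]

theorem ae_eq_zero_of_mInt_freeSys (h0 : 0 < ξ₀) (h1 : ξ₀ < π) (c : ℝ) {f : ℂ → ℂ}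
    (hm : Measurable fun θ : ℝ => f (circPt θ))
    (hsq : IntervalIntegrable (fun θ : ℝ => ‖f (circPt θ)‖ ^ 2) volume 0 (2 * π))
    (h : ∀ n : ℤ, mInt (fun z => f z * conj (freeSys ξ₀ c n z)) = 0) :
    ∀ᵐ θ ∂(volume.restrict (Set.Ioc (0 : ℝ) (2 * π))), f (circPt θ) = 0 := by
  have hm' : Measurable fun θ : ℝ => conj (f (circPt θ)) :=
    Complex.continuous_conj.measurable.comp hm
  have hF : IntervalIntegrable (fun θ => conj (f (circPt θ))) volume 0 (2 * π) :=
    intervalIntegrable_of_sq hm' (by simpa using hsq)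
  have hzero := ae_eq_zero_of_pairing_eq_zero hF <| pairing_eq_zero_of_freeSys h0 h1 c hF fun n =>
    pairing_onCircle_eq_zero hF _ (f := fun z => conj (f z)) rfl <| by
      have h2 := congrArg conj (h n)
      rw [← mInt_conj, map_zero] at h2
      simpa using h2
  filter_upwards [hzero] with θ hθ
  simpa using hθ

end Completeness

section DiscAlgebra

variable {ξ₀ : ℝ} {z : ℂ}

/-- The disc algebra, as the closure of the polynomials in the continuous functions on the
circle. -/
def discAlgebra : Subalgebra ℂ C(AddCircle (2 * π), ℂ) :=
  (Algebra.adjoin ℂ {onCircle (fun z => z) continuousOn_id}).topologicalClosure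

theorem isClosed_discAlgebra : IsClosed (discAlgebra : Set C(AddCircle (2 * π), ℂ)) :=
  Subalgebra.isClosed_topologicalClosure _

theorem onCircle_id_mem_discAlgebra : onCircle (fun z => z) continuousOn_id ∈ discAlgebra :=
  Subalgebra.le_topologicalClosure _ (Algebra.self_mem_adjoin_singleton ℂ _)

theorem onCircle_inv_one_sub_mem_discAlgebra {w : ℂ} (hw : ‖w‖ < 1)
    (hc : ContinuousOn (fun z => (1 - w * z)⁻¹) (Metric.sphere 0 1)) :
    onCircle (fun z => (1 - w * z)⁻¹) hc ∈ discAlgebra := by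
  set Z := onCircle (fun z => z) continuousOn_id with hZ
  have hnorm : ‖w • Z‖ < 1 := by
    rw [ContinuousMap.norm_lt_iff _ one_pos]
    intro x
    rw [ContinuousMap.smul_apply, norm_smul, hZ, onCircle_apply, Circle.norm_coe, mul_one]
    exact hw
  have hsum := geom_series_mul_neg (w • Z) hnorm
  have heq : onCircle (fun z => (1 - w * z)⁻¹) hc = ∑' n : ℕ, (w • Z) ^ n := by
    ext x
    have hx := DFunLike.congr_fun hsum x
    simp only [ContinuousMap.mul_apply, ContinuousMap.sub_apply, ContinuousMap.one_apply,
      ContinuousMap.smul_apply, smul_eq_mul] at hx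
    exact (eq_inv_of_mul_eq_one_left hx).symm
  rw [heq]
  refine tsum_mem isClosed_discAlgebra fun n => ?_
  exact pow_mem (discAlgebra.smul_mem onCircle_id_mem_discAlgebra w) n

theorem pairing_id_mul_discAlgebra {F : ℝ → ℂ} (hF : IntervalIntegrable F volume 0 (2 * π))
    (h : ∀ k : ℕ, pairing F hF (onCircle (fun z => z) continuousOn_id ^ (k + 1)) = 0)
    {g : C(AddCircle (2 * π), ℂ)} (hg : g ∈ discAlgebra) :
    pairing F hF (onCircle (fun z => z) continuousOn_id * g) = 0 := by
  have hclosed : IsClosed {g : C(AddCircle (2 * π), ℂ) |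
      pairing F hF (onCircle (fun z => z) continuousOn_id * g) = 0} :=
    isClosed_eq (by fun_prop) continuous_const
  refine closure_minimal (fun g hg => ?_) hclosed hg
  rw [SetLike.mem_coe, Algebra.adjoin_singleton_eq_range_aeval] at hg
  obtain ⟨p, rfl⟩ := hg
  change pairing F hF (onCircle (fun z => z) continuousOn_id *
    Polynomial.aeval (onCircle (fun z => z) continuousOn_id) p) = 0
  induction p using Polynomial.induction_on' with
  | add p q hp hq =>
    rw [map_add, mul_add, map_add, hp, hq, add_zero]
  | monomial n a =>
    rw [Polynomial.aeval_monomial, ← Algebra.smul_def, mul_smul_comm, ← pow_succ', map_smul, h, smul_zero]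

theorem onCircle_inv_one_sub_kpt (h0 : 0 < ξ₀) (h1 : ξ₀ < π) :
    ∃ u ∈ discAlgebra, ∀ x : AddCircle (2 * π),
      u x = (1 - tanParam ξ₀ * (I * AddCircle.toCircle x))⁻¹ := by
  have ht : ‖(tanParam ξ₀ : ℂ) * I‖ < 1 := by
    simpa [abs_of_pos (tanParam_pos h0 h1)] using tanParam_lt_one h0 h1
  refine ⟨_, onCircle_inv_one_sub_mem_discAlgebra ht ?_, fun x => ?_⟩
  · refine ContinuousOn.inv₀ (by fun_prop) fun z hz => ?_
    rw [mul_assoc]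
    exact one_sub_ne_zero h0 h1 (mem_sphere_zero_iff_norm.1 hz).le
  · rw [onCircle_apply, mul_assoc]

theorem onCircle_inv_one_add_kpt (h0 : 0 < ξ₀) (h1 : ξ₀ < π) :
    ∃ u ∈ discAlgebra, ∀ x : AddCircle (2 * π),
      u x = (1 + tanParam ξ₀ * (I * AddCircle.toCircle x))⁻¹ := by
  have ht : ‖-((tanParam ξ₀ : ℂ) * I)‖ < 1 := by
    simpa [abs_of_pos (tanParam_pos h0 h1)] using tanParam_lt_one h0 h1
  refine ⟨_, onCircle_inv_one_sub_mem_discAlgebra ht ?_, fun x => ?_⟩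
  · refine ContinuousOn.inv₀ (by fun_prop) fun z hz => ?_
    rw [neg_mul, sub_neg_eq_add, mul_assoc]
    exact one_add_ne_zero h0 h1 (mem_sphere_zero_iff_norm.1 hz).le
  · rw [onCircle_apply, neg_mul, sub_neg_eq_add, mul_assoc]

theorem onCircle_bk_mem_discAlgebra (h0 : 0 < ξ₀) (h1 : ξ₀ < π) :
    onCircle (bk ξ₀) (continuousOn_bk h0 h1) ∈ discAlgebra := by
  obtain ⟨u, hu, hux⟩ := onCircle_inv_one_sub_kpt h0 h1
  convert mul_mem (sub_mem (discAlgebra.smul_mem (one_mem _) (tanParam ξ₀ : ℂ))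
    (discAlgebra.smul_mem onCircle_id_mem_discAlgebra I)) hu using 1
  ext x
  simp [onCircle_apply, hux, bk_eq, div_eq_mul_inv]

theorem onCircle_bkb_mem_discAlgebra (h0 : 0 < ξ₀) (h1 : ξ₀ < π) :
    onCircle (bkb ξ₀) (continuousOn_bkb h0 h1) ∈ discAlgebra := by
  obtain ⟨u, hu, hux⟩ := onCircle_inv_one_add_kpt h0 h1
  convert mul_mem (add_mem (discAlgebra.smul_mem (one_mem _) (tanParam ξ₀ : ℂ))
    (discAlgebra.smul_mem onCircle_id_mem_discAlgebra I)) hu using 1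
  ext x
  simp [onCircle_apply, hux, bkb_eq, div_eq_mul_inv]

theorem onCircle_Kker_kpt_mem_discAlgebra (h0 : 0 < ξ₀) (h1 : ξ₀ < π) :
    onCircle (Kker (kpt ξ₀)) (continuousOn_sphere_of_differentiableAt fun _ =>
      differentiableAt_Kker_kpt h0 h1) ∈ discAlgebra := by
  obtain ⟨u, hu, hux⟩ := onCircle_inv_one_sub_kpt h0 h1
  convert discAlgebra.smul_mem hu (kerScale ξ₀ : ℂ) using 1
  ext x
  simp [onCircle_apply, hux, Kker_kpt h0 h1, div_eq_mul_inv]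

theorem onCircle_Kker_conj_kpt_mem_discAlgebra (h0 : 0 < ξ₀) (h1 : ξ₀ < π) :
    onCircle (Kker (conj (kpt ξ₀))) (continuousOn_sphere_of_differentiableAt fun _ =>
      differentiableAt_Kker_conj_kpt h0 h1) ∈ discAlgebra := by
  obtain ⟨u, hu, hux⟩ := onCircle_inv_one_add_kpt h0 h1
  convert discAlgebra.smul_mem hu (kerScale ξ₀ : ℂ) using 1
  ext x
  simp [onCircle_apply, hux, Kker_conj_kpt h0 h1, div_eq_mul_inv]

theorem bkb_mul_conj_Kker (h0 : 0 < ξ₀) (h1 : ξ₀ < π) (hz : ‖z‖ = 1) :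
    bkb ξ₀ z * conj (Kker (conj (kpt ξ₀)) z) = z * (I * Kker (conj (kpt ξ₀)) z) := by
  have hz0 : z ≠ 0 := by rintro rfl; simp at hz
  have hn := add_I_mul_ne_zero h0 h1 hz
  have hd := one_add_ne_zero h0 h1 hz.le
  have hconj : conj (Kker (conj (kpt ξ₀)) z) =
      kerScale ξ₀ * (I * z) / (tanParam ξ₀ + I * z) := by
    rw [Kker_conj_kpt h0 h1, eq_div_iff hn]
    simp only [map_div₀, map_add, map_mul, map_one, conj_ofReal, conj_I, conj_eq_inv hz]
    have hd' : 1 + (tanParam ξ₀ : ℂ) * (-I * z⁻¹) ≠ 0 := by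
      intro h
      apply hn
      have h2 := congrArg (fun w => w * (I * z)) h
      field_simp at h2
      linear_combination I * h2 + (tanParam ξ₀ : ℂ) * I_sq
    rw [div_mul_eq_mul_div, div_eq_iff hd']
    field_simp
    linear_combination ((kerScale ξ₀ : ℂ) * tanParam ξ₀) * I_sq
  rw [hconj, bkb_eq, Kker_conj_kpt h0 h1]
  field_simp

theorem bk_mul_conj_Kker (h0 : 0 < ξ₀) (h1 : ξ₀ < π) (hz : ‖z‖ = 1) :
    bk ξ₀ z * conj (Kker (kpt ξ₀) z) = z * (-I * Kker (kpt ξ₀) z) := by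
  have h := bkb_mul_conj_Kker h0 h1 (z := -z) (by simpa using hz)
  rw [bkb_eq_bk_neg, neg_neg] at h
  have hK : Kker (conj (kpt ξ₀)) (-z) = Kker (kpt ξ₀) z := by
    rw [Kker_conj_kpt h0 h1, Kker_kpt h0 h1]
    ring_nf
  rw [hK] at h
  rw [h]
  ring

theorem exists_conj_freeSys_eq (h0 : 0 < ξ₀) (h1 : ξ₀ < π) (c : ℝ) {n : ℤ} (hn : n < 0)
    (hc : ContinuousOn (fun z => conj (freeSys ξ₀ c n z)) (Metric.sphere 0 1)) :
    ∃ g ∈ discAlgebra, onCircle (fun z => conj (freeSys ξ₀ c n z)) hc =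
      onCircle (fun z => z) continuousOn_id * g := by
  have hb := onCircle_bk_mem_discAlgebra h0 h1
  have hb' := onCircle_bkb_mem_discAlgebra h0 h1
  have hinv (k : ℕ) {w : ℂ} (hw : w * conj w = 1) : conj (w ^ (-(k : ℤ))) = w ^ k := by
    rw [map_zpow₀, eq_inv_of_mul_eq_one_right hw]
    simp
  obtain ⟨m, rfl | rfl⟩ := n.even_or_odd'
  · obtain ⟨k, rfl⟩ : ∃ k : ℕ, m = -((k + 1 : ℕ) : ℤ) := ⟨(-m - 1).toNat, by omega⟩
    refine ⟨_, discAlgebra.smul_mem (mul_mem (mul_mem (pow_mem hb (k + 1)) (pow_mem hb' k))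
      (onCircle_Kker_conj_kpt_mem_discAlgebra h0 h1)) (I * conj (Complex.exp (c * I))), ?_⟩
    ext x
    have hx : ‖(AddCircle.toCircle x : ℂ)‖ = 1 := Circle.norm_coe _
    simp only [ContinuousMap.mul_apply, ContinuousMap.smul_apply, ContinuousMap.pow_apply,
      onCircle_apply, smul_eq_mul, freeSys_even]
    rw [map_mul, map_mul, map_mul, hinv _ (bk_mul_conj h0 h1 hx), hinv _ (bkb_mul_conj h0 h1 hx)]
    linear_combination (bk ξ₀ (AddCircle.toCircle x) ^ (k + 1) *
      bkb ξ₀ (AddCircle.toCircle x) ^ k * conj (Complex.exp (c * I))) *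
      bkb_mul_conj_Kker h0 h1 hx
  · obtain ⟨k, rfl⟩ : ∃ k : ℕ, m = -((k + 1 : ℕ) : ℤ) := ⟨(-m - 1).toNat, by omega⟩
    refine ⟨_, discAlgebra.smul_mem (mul_mem (mul_mem (pow_mem hb k) (pow_mem hb' k))
      (onCircle_Kker_kpt_mem_discAlgebra h0 h1)) (-I), ?_⟩
    ext x
    have hx : ‖(AddCircle.toCircle x : ℂ)‖ = 1 := Circle.norm_coe _
    simp only [ContinuousMap.mul_apply, ContinuousMap.smul_apply, ContinuousMap.pow_apply,
      onCircle_apply, smul_eq_mul, freeSys_odd h0 h1 c _ hx]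
    rw [map_mul, map_mul, map_mul, hinv _ (bk_mul_conj h0 h1 hx), hinv _ (bkb_mul_conj h0 h1 hx)]
    linear_combination (bk ξ₀ (AddCircle.toCircle x) ^ (k + 1) *
      bkb ξ₀ (AddCircle.toCircle x) ^ k * conj (Kker (kpt ξ₀) (AddCircle.toCircle x))) *
      bkb_mul_conj h0 h1 hx + (bk ξ₀ (AddCircle.toCircle x) ^ k *
      bkb ξ₀ (AddCircle.toCircle x) ^ k) * bk_mul_conj_Kker h0 h1 hx

theorem MemH2.mInt_mul_conj_freeSys_eq_zero (h0 : 0 < ξ₀) (h1 : ξ₀ < π) (c : ℝ) {f : ℂ → ℂ}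
    (hf : MemH2 f) {n : ℤ} (hn : n < 0) :
    mInt (fun z => f z * conj (freeSys ξ₀ c n z)) = 0 := by
  obtain ⟨hm, hsq, hk⟩ := hf
  have hF := intervalIntegrable_of_sq hm hsq
  have hc := continuousOn_conj (continuousOn_freeSys h0 h1 c n)
  obtain ⟨g, hg, heq⟩ := exists_conj_freeSys_eq h0 h1 c hn hc
  have hpow (k : ℕ) : pairing _ hF (onCircle (fun z => z) continuousOn_id ^ (k + 1)) = 0 :=
    pairing_onCircle_eq_zero hF (g := fun z => z ^ (k + 1)) (by fun_prop) rfl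
      (hk (k + 1) k.succ_pos)
  have hp := pairing_id_mul_discAlgebra hF hpow hg
  rw [← heq, pairing_apply] at hp
  simp only [onCircle_coe] at hp
  rw [mInt, hp, mul_zero]

end DiscAlgebra

/-- The system 𝔢_{n,c} (with 𝔢_{2m,c} = b_κ^m b_{κ̄}^m K_{κ̄} e^{ic},
𝔢_{2m+1,c} = b_κ^m b_{κ̄}^{m+1} K_κ) is an orthonormal basis of H² for n ∈ ℤ₊ and of
L²(𝕋) for n ∈ ℤ, and with respect to it the operator of multiplication by
v = b_κ/b_{κ̄} is the CMV matrix with constant Verblunsky coefficients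
a_n = e^{ic}·sin(ξ₀/2). -/
theorem cmv_constant_coefficients_free_basis (ξ₀ c : ℝ) (h0 : 0 < ξ₀) (h1 : ξ₀ < π) :
    -- orthonormality in L²(𝕋)
    (∀ m n : ℤ,
      mInt (fun τ => freeSys ξ₀ c n τ * conj (freeSys ξ₀ c m τ))
        = if m = n then 1 else 0) ∧
    -- for n ∈ ℤ₊ the system lies in H²
    (∀ n : ℤ, 0 ≤ n → MemH2 (freeSys ξ₀ c n)) ∧
    -- completeness in H² (basis of H² for n ∈ ℤ₊)
    (∀ f : ℂ → ℂ, MemH2 f →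
      (∀ n : ℤ, 0 ≤ n → mInt (fun τ => f τ * conj (freeSys ξ₀ c n τ)) = 0) →
      ∀ᵐ θ ∂(volume.restrict (Set.Ioc (0:ℝ) (2*π))), f (circPt θ) = 0) ∧
    -- completeness in L²(𝕋) (basis of L² for n ∈ ℤ)
    (∀ f : ℂ → ℂ, Measurable (fun θ : ℝ => f (circPt θ)) →
      IntervalIntegrable (fun θ : ℝ => ‖f (circPt θ)‖^2) volume 0 (2*π) →
      (∀ n : ℤ, mInt (fun τ => f τ * conj (freeSys ξ₀ c n τ)) = 0) →
      ∀ᵐ θ ∂(volume.restrict (Set.Ioc (0:ℝ) (2*π))), f (circPt θ) = 0) ∧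
    -- with respect to this basis, multiplication by v is the CMV matrix 𝔄_a with
    -- constant coefficients a = e^{ic} sin(ξ₀/2)
    (∀ m n : ℤ,
      mInt (fun τ => vmap ξ₀ τ * freeSys ξ₀ c n τ * conj (freeSys ξ₀ c m τ))
        = CMVop (fun _ => Complex.exp (c * Complex.I) * (Real.sin (ξ₀/2) : ℝ))
            (deltaVec n) m) := by
  refine ⟨mInt_freeSys h0 h1 c, fun n hn => memH2_freeSys h0 h1 c hn, fun f hf h => ?_,
    fun f hm hsq h => ae_eq_zero_of_mInt_freeSys h0 h1 c hm hsq h, mInt_vmap_freeSys h0 h1 c⟩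
  refine ae_eq_zero_of_mInt_freeSys h0 h1 c hf.1 hf.2.1 fun n => ?_
  obtain hn | hn := le_or_gt 0 n
  · exact h n hn
  · exact hf.mInt_mul_conj_freeSys_eq_zero h0 h1 c hn

end
end

section
/- Let 𝔴̃ ∈ A₂[−2,2] and let φ be the outer function in Ω = ℂ̄∖[−2,2] with |φ|² = 𝔴̃ on the boundary [−2,2] and φ(∞) > 0. Then for x > 2 (with 4−x ≥ −2) there are constants 0 < c < C < ∞ independent of x such that c·(1/(x−2))·∫_{4−x}^{2} 𝔴̃(t) dt ≤ |φ(x)|² ≤ C·(1/(x−2))·∫_{4−x}^{2} 𝔴̃(t) dt. -/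
open MeasureTheory Complex ComplexConjugate Filter
open scoped ComplexOrder

noncomputable section

local notation "π" => Real.pi

end

noncomputable section

open MeasureTheory Complex ComplexConjugate Filter

local notation "π" => Real.pi

/-- √(z²-4) with the branch cut on [-2,2], behaving like z at infinity. -/
def sqrtZsq (z : ℂ) : ℂ := (z - 2) ^ ((1:ℂ)/2) * (z + 2) ^ ((1:ℂ)/2)

/-- The outer (Szegő) function φ in Ω = ℂ̄∖[-2,2] with |φ|² = w on both sides of the
boundary [-2,2] and φ(∞) > 0, given by the exponential of the harmonic extension of
log √w. -/
def szegoOuter (w : ℝ → ℝ) (z : ℂ) : ℂ :=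
  Complex.exp (sqrtZsq z / (2*π) *
    ∫ t in (-2:ℝ)..2, (Real.log (w t) : ℂ) / ((z - (t:ℂ)) * (Real.sqrt (4 - t^2) : ℝ)))

/-- The A₂ condition on [-2,2]. -/
def A2onSegment (w : ℝ → ℝ) : Prop :=
  ∃ C : ℝ, ∀ a b : ℝ, -2 ≤ a → a < b → b ≤ 2 →
    ((b - a)⁻¹ * ∫ t in a..b, w t) * ((b - a)⁻¹ * ∫ t in a..b, (w t)⁻¹) ≤ C

/-- In the variables `h = x - 2`, `s = 2 - t`, the harmonic measure density of `ℂ̄ ∖ [-2,2]`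
seen from the point `x`. -/
def harmKernel (h s : ℝ) : ℝ := √(h * (h + 4)) / (π * (h + s) * √(s * (4 - s)))

lemma harmKernel_nonneg {h s : ℝ} (hh : 0 < h) (hs : 0 < s) : 0 ≤ harmKernel h s := by
  unfold harmKernel
  have := Real.pi_pos
  positivity

lemma measurable_harmKernel (h : ℝ) : Measurable (harmKernel h) := by
  unfold harmKernel
  fun_prop

lemma hasDerivAt_harmKernel_primitive {h s : ℝ} (hh : 0 < h) (hs : s ∈ Set.Ioo (0 : ℝ) 4) :
    HasDerivAt (fun s => π⁻¹ * Real.arccos (1 - (h + 4) * s / (2 * (h + s))))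
      (harmKernel h s) s := by
  obtain ⟨h0, h4⟩ := hs
  have hsum : 0 < h + s := by positivity
  have hq : HasDerivAt (fun s => 1 - (h + 4) * s / (2 * (h + s)))
      (-((h + 4) * h / (2 * (h + s) ^ 2))) s := by
    have h1 := (((hasDerivAt_id s).const_mul (h + 4)).div
      (((hasDerivAt_id s).const_add h).const_mul 2) (by simp; positivity)).const_sub 1
    convert! h1 using 1
    simp only [id]
    field_simp
    ring
  set y := 1 - (h + 4) * s / (2 * (h + s)) with hy
  have e : 1 - y ^ 2 = (h * (h + 4)) * (s * (4 - s)) / (2 * (h + s)) ^ 2 := by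
    rw [hy]; field_simp; ring
  have hpos : 0 < 1 - y ^ 2 := by
    rw [e]
    have : 0 < 4 - s := by linarith
    positivity
  have hy1 : y ≠ -1 := fun hc => by simp [hc] at hpos
  have hy2 : y ≠ 1 := fun hc => by simp [hc] at hpos
  have h2 := ((Real.hasDerivAt_arccos hy1 hy2).comp s hq).const_mul π⁻¹
  convert! h2 using 1
  rw [e, Real.sqrt_div' _ (by positivity), Real.sqrt_sq (by positivity),
    Real.sqrt_mul (by positivity), harmKernel]
  have hA : 0 < √(h * (h + 4)) := Real.sqrt_pos.2 (by positivity)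
  have hB : 0 < √(s * (4 - s)) := Real.sqrt_pos.2 (mul_pos h0 (by linarith))
  have hA2 : √(h * (h + 4)) ^ 2 = h * (h + 4) := Real.sq_sqrt (by positivity)
  have := Real.pi_pos
  field_simp
  rw [hA2]

lemma continuousOn_harmKernel_primitive {h : ℝ} (hh : 0 < h) :
    ContinuousOn (fun s => π⁻¹ * Real.arccos (1 - (h + 4) * s / (2 * (h + s)))) (Set.Icc 0 4) := by
  refine continuousOn_const.mul (Real.continuous_arccos.comp_continuousOn ?_)
  refine continuousOn_const.sub (ContinuousOn.div (by fun_prop) (by fun_prop) ?_)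
  intro s hs
  have := hs.1
  positivity

lemma intervalIntegrable_harmKernel {h : ℝ} (hh : 0 < h) :
    IntervalIntegrable (harmKernel h) volume 0 4 := by
  refine intervalIntegral.intervalIntegrable_deriv_of_nonneg
    (g := fun s => π⁻¹ * Real.arccos (1 - (h + 4) * s / (2 * (h + s)))) ?_ ?_ ?_
  · rw [Set.uIcc_of_le (by norm_num)]
    exact continuousOn_harmKernel_primitive hh
  · intro s hs
    norm_num at hs
    exact hasDerivAt_harmKernel_primitive hh hs
  · intro s hs
    norm_num at hs
    exact harmKernel_nonneg hh hs.1

lemma integral_harmKernel {h : ℝ} (hh : 0 < h) : ∫ s in (0 : ℝ)..4, harmKernel h s = 1 := by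
  rw [intervalIntegral.integral_eq_sub_of_hasDerivAt_of_le (by norm_num)
    (continuousOn_harmKernel_primitive hh) (fun s hs => hasDerivAt_harmKernel_primitive hh hs)
    (intervalIntegrable_harmKernel hh)]
  have e : 1 - (h + 4) * 4 / (2 * (h + 4)) = -1 := by field_simp; norm_num
  rw [e]
  simp [Real.pi_ne_zero]

/-- Pointwise bound of the kernel separating its two endpoint singularities. -/
lemma harmKernel_le {h s : ℝ} (hh : 0 < h) (hh4 : h ≤ 4) (hs : s ∈ Set.Ioo (0 : ℝ) 4) :
    harmKernel h s ≤ √h / ((h + s) * √s) + √h / √(4 - s) := by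
  obtain ⟨h0, h4⟩ := hs
  have h4' : 0 < 4 - s := by linarith
  have hsh : 0 < √h := Real.sqrt_pos.2 hh
  have hs1 : 0 < √s := Real.sqrt_pos.2 h0
  have hs2 : 0 < √(4 - s) := Real.sqrt_pos.2 h4'
  have hpi := Real.pi_gt_three
  have h8 : √(h + 4) ≤ 3 := Real.sqrt_le_iff.2 ⟨by norm_num, by linarith⟩
  rw [harmKernel, Real.sqrt_mul hh.le, Real.sqrt_mul h0.le]
  have hP : √h * √(h + 4) / (π * (h + s) * (√s * √(4 - s))) ≤
      √h / ((h + s) * (√s * √(4 - s))) := by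
    rw [div_le_div_iff₀ (by positivity) (by positivity)]
    have : √(h + 4) ≤ π := by linarith
    have := mul_le_mul_of_nonneg_left this
      (show 0 ≤ √h * ((h + s) * (√s * √(4 - s))) by positivity)
    linarith
  refine hP.trans ?_
  rcases le_total s 2 with hs' | hs'
  · have : 1 ≤ √(4 - s) := Real.one_le_sqrt.2 (by linarith)
    have h1 : √h / ((h + s) * (√s * √(4 - s))) ≤ √h / ((h + s) * √s) := by
      gcongr
      exact le_mul_of_one_le_right hs1.le this
    have : 0 ≤ √h / √(4 - s) := by positivity
    linarith
  · have : 1 ≤ √s := Real.one_le_sqrt.2 (by linarith)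
    have h1 : √h / ((h + s) * (√s * √(4 - s))) ≤ √h / √(4 - s) := by
      gcongr
      have : 1 ≤ (h + s) * √s := one_le_mul_of_one_le_of_one_le (by linarith) this
      nlinarith
    have : 0 ≤ √h / ((h + s) * √s) := by positivity
    linarith

lemma posLog_le_pow_mul_add_div (n : ℕ) {b u : ℝ} (hb : 0 < b) (hu : 0 < u) :
    Real.posLog u ≤ b ^ n * u + n / b := by
  refine max_le (by positivity) ?_
  have e : Real.log u = Real.log (b ^ n * u) + n * Real.log b⁻¹ := by
    rw [Real.log_mul (by positivity) hu.ne', Real.log_pow, Real.log_inv]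
    ring
  rw [e, div_eq_mul_inv]
  have h1 := Real.log_le_self (show 0 ≤ b ^ n * u by positivity)
  have h2 := Real.log_le_self (show 0 ≤ b⁻¹ by positivity)
  gcongr

lemma nearKernel_mul_posLog_le {h s u : ℝ} (hh : 0 < h) (hs : 0 < s) (hu : 0 < u) :
    √h / ((h + s) * √s) * Real.posLog u ≤
      h ^ 2 / (h + s) ^ 3 * u +
        72 * (1 / (4 * h * √√(s / h) ^ 3 * (1 + √√(s / h)) ^ 2)) := by
  set x := √√(s / h) with hx
  have hx0 : 0 < x := Real.sqrt_pos.2 (Real.sqrt_pos.2 (by positivity))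
  have hx2 : x ^ 2 = √(s / h) := Real.sq_sqrt (Real.sqrt_nonneg _)
  have hx4 : x ^ 4 = s / h := by
    rw [show x ^ 4 = (x ^ 2) ^ 2 by ring, hx2, Real.sq_sqrt (by positivity)]
  have es : s = h * x ^ 4 := by rw [hx4]; field_simp
  have esq : √s = √h * x ^ 2 := by
    rw [hx2, ← Real.sqrt_mul hh.le]; congr 1; field_simp
  have hsh : 0 < √h := Real.sqrt_pos.2 hh
  have ek : √h / ((h + s) * √s) = 1 / (h * x ^ 2 * (1 + x ^ 4)) := by
    rw [esq, es]; field_simp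
  set q := √(1 + x ^ 4) with hq
  have hq0 : 0 < q := Real.sqrt_pos.2 (by positivity)
  have hq2 : q ^ 2 = 1 + x ^ 4 := Real.sq_sqrt (by positivity)
  have hlog := posLog_le_pow_mul_add_div 6 (b := x / q) (by positivity) hu
  have hqx : (1 + x) ^ 2 ≤ 3 * q := by
    refine le_of_sq_le_sq ?_ (by positivity)
    have : (3 * q) ^ 2 = 9 * (1 + x ^ 4) := by rw [mul_pow, hq2]; norm_num
    rw [this]
    nlinarith [sq_nonneg (x ^ 2 - 1), sq_nonneg (x - 1), sq_nonneg (x ^ 2 - x), sq_nonneg x]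
  have e1 : 1 / (h * x ^ 2 * (1 + x ^ 4)) * ((x / q) ^ 6 * u) ≤ h ^ 2 / (h + s) ^ 3 * u := by
    have : 1 / (h * x ^ 2 * (1 + x ^ 4)) * ((x / q) ^ 6 * u) =
        h ^ 2 / (h + s) ^ 3 * u * (x ^ 4 / (1 + x ^ 4)) := by
      rw [div_pow, show q ^ 6 = (q ^ 2) ^ 3 by ring, hq2, es]
      field_simp
    rw [this]
    refine mul_le_of_le_one_right (by positivity) ?_
    rw [div_le_one (by positivity)]
    linarith
  have e2 : 1 / (h * x ^ 2 * (1 + x ^ 4)) * ((6 : ℕ) / (x / q)) ≤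
      72 * (1 / (4 * h * x ^ 3 * (1 + x) ^ 2)) := by
    rw [← hq2]
    have : 1 / (h * x ^ 2 * q ^ 2) * ((6 : ℕ) / (x / q)) = 18 / (h * x ^ 3 * (3 * q)) := by
      push_cast; field_simp; norm_num
    rw [this]
    have : 72 * (1 / (4 * h * x ^ 3 * (1 + x) ^ 2)) = 18 / (h * x ^ 3 * (1 + x) ^ 2) := by
      field_simp; norm_num
    rw [this]
    gcongr
  rw [ek]
  calc _ ≤ 1 / (h * x ^ 2 * (1 + x ^ 4)) * ((x / q) ^ 6 * u + (6 : ℕ) / (x / q)) := by gcongr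
    _ ≤ _ := by rw [mul_add]; exact add_le_add e1 e2

lemma farKernel_mul_posLog_le {h s u : ℝ} (hh : 0 < h) (hh4 : h ≤ 4) (hs : s < 4) (hu : 0 < u) :
    √h / √(4 - s) * Real.posLog u ≤ h * u + 16 * (1 / (4 * √√(4 - s) ^ 3)) := by
  set y := √√(4 - s) with hy
  set g := √√h with hg
  have hs' : 0 < √(4 - s) := Real.sqrt_pos.2 (by linarith)
  have hh' : 0 < √h := Real.sqrt_pos.2 hh
  have hy0 : 0 < y := Real.sqrt_pos.2 hs'
  have hg0 : 0 < g := Real.sqrt_pos.2 hh'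
  have hy2 : √(4 - s) = y ^ 2 := (Real.sq_sqrt hs'.le).symm
  have hg2 : √h = g ^ 2 := (Real.sq_sqrt hh'.le).symm
  have hg4 : h = g ^ 4 := by
    rw [show g ^ 4 = (g ^ 2) ^ 2 by ring, ← hg2, Real.sq_sqrt hh.le]
  have hg_le : g ≤ 2 := by
    by_contra! hc
    have : (2 : ℝ) ^ 4 < g ^ 4 := by gcongr
    linarith
  have hlog := posLog_le_pow_mul_add_div 2 (b := g * y) (by positivity) hu
  rw [hy2, hg2, hg4]
  calc _ ≤ g ^ 2 / y ^ 2 * ((g * y) ^ 2 * u + (2 : ℕ) / (g * y)) := by gcongr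
    _ = g ^ 4 * u + 2 * g / y ^ 3 := by push_cast; field_simp
    _ ≤ g ^ 4 * u + 2 * 2 / y ^ 3 := by gcongr
    _ = _ := by field_simp; ring

lemma hasDerivAt_near_primitive {h s : ℝ} (hh : 0 < h) (hs : 0 < s) :
    HasDerivAt (fun s => √√(s / h) / (1 + √√(s / h)))
      (1 / (4 * h * √√(s / h) ^ 3 * (1 + √√(s / h)) ^ 2)) s := by
  have h0 : 0 < √(s / h) := Real.sqrt_pos.2 (by positivity)
  have hx0 : 0 < √√(s / h) := Real.sqrt_pos.2 h0
  have h1 := (((hasDerivAt_id s).div_const h).sqrt (div_pos hs hh).ne').sqrt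
    (by simpa using h0.ne')
  have h2 := h1.div (h1.const_add 1) (add_pos one_pos hx0).ne'
  convert! h2 using 1
  have e : √(s / h) = √√(s / h) ^ 2 := (Real.sq_sqrt h0.le).symm
  simp only [id]
  generalize √√(s / h) = x at *
  rw [e]
  field_simp
  ring

lemma hasDerivAt_far_primitive {s : ℝ} (hs : s < 4) :
    HasDerivAt (fun s => -√√(4 - s)) (1 / (4 * √√(4 - s) ^ 3)) s := by
  have h0 : 0 < √(4 - s) := Real.sqrt_pos.2 (by linarith)
  have hx0 : 0 < √√(4 - s) := Real.sqrt_pos.2 h0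
  have h2 := ((((hasDerivAt_id s).const_sub 4).sqrt (by simp; linarith)).sqrt
    (by simpa using h0.ne')).neg
  convert! h2 using 1
  have e : √(4 - s) = √√(4 - s) ^ 2 := (Real.sq_sqrt h0.le).symm
  simp only [id]
  generalize √√(4 - s) = x at *
  rw [e]
  field_simp
  ring

/-- The error density in the pointwise bound of `harmKernel h s * log⁺ u`. -/
def harmError (h s : ℝ) : ℝ :=
  72 * (1 / (4 * h * √√(s / h) ^ 3 * (1 + √√(s / h)) ^ 2)) + 16 * (1 / (4 * √√(4 - s) ^ 3))

lemma harmKernel_mul_posLog_le {h s u : ℝ} (hh : 0 < h) (hh4 : h ≤ 4)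
    (hs : s ∈ Set.Ioo (0 : ℝ) 4) (hu : 0 < u) :
    harmKernel h s * Real.posLog u ≤ h ^ 2 / (h + s) ^ 3 * u + h * u + harmError h s := by
  have h1 := mul_le_mul_of_nonneg_right (harmKernel_le hh hh4 hs)
    (Real.posLog_nonneg (x := u))
  have h2 := nearKernel_mul_posLog_le hh hs.1 hu
  have h3 := farKernel_mul_posLog_le hh hh4 hs.2 hu
  rw [harmError]
  linarith

lemma harmError_integral {h : ℝ} (hh : 0 < h) :
    IntervalIntegrable (harmError h) volume 0 4 ∧ ∫ s in (0 : ℝ)..4, harmError h s ≤ 104 := by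
  set P := fun s => 72 * (√√(s / h) / (1 + √√(s / h))) + 16 * (-√√(4 - s)) with hP
  have hc : ContinuousOn P (Set.Icc 0 4) := by
    refine ContinuousOn.add (continuousOn_const.mul (ContinuousOn.div (by fun_prop)
      (by fun_prop) fun s _ => ?_)) (by fun_prop)
    positivity
  have hd : ∀ s ∈ Set.Ioo (0 : ℝ) 4, HasDerivAt P (harmError h s) s := fun s hs =>
    ((hasDerivAt_near_primitive hh hs.1).const_mul 72).add
      ((hasDerivAt_far_primitive hs.2).const_mul 16)
  have hi : IntervalIntegrable (harmError h) volume 0 4 := by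
    refine intervalIntegral.intervalIntegrable_deriv_of_nonneg (g := P) ?_ ?_ ?_
    · rwa [Set.uIcc_of_le (by norm_num)]
    · intro s hs
      norm_num at hs
      exact hd s hs
    · intro s _
      unfold harmError
      positivity
  refine ⟨hi, ?_⟩
  rw [intervalIntegral.integral_eq_sub_of_hasDerivAt_of_le (by norm_num) hc hd hi]
  have h1 : √√((4 : ℝ) / h) / (1 + √√(4 / h)) ≤ 1 := by
    rw [div_le_one (by positivity)]
    linarith
  have h2 : √√(4 : ℝ) ≤ 2 := by
    rw [Real.sqrt_le_iff, Real.sqrt_le_iff]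
    norm_num
  simp only [hP, sub_self, sub_zero, zero_div, Real.sqrt_zero, neg_zero, mul_zero,
    zero_add, add_zero]
  generalize √√(4 : ℝ) = a at *
  generalize √√((4 : ℝ) / h) / (1 + √√(4 / h)) = b at *
  linarith

/-- A polynomial growth bound on the primitive of `u` controls its integral against a
sufficiently concentrated weight. -/
lemma integral_concentrated_weight_le {h M : ℝ} (hh : 0 < h) (hM : 0 ≤ M) {u : ℝ → ℝ}
    (hu : IntervalIntegrable u volume 0 4)
    (hgrow : ∀ s ∈ Set.Icc (0 : ℝ) 4, ∫ r in (0 : ℝ)..s, u r ≤ M * ((h + s) ^ 2 / h)) :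
    ∫ s in (0 : ℝ)..4, h ^ 2 / (h + s) ^ 3 * u s ≤ 4 * M := by
  have hne : ∀ s ∈ Set.uIcc (0 : ℝ) 4, h + s ≠ 0 := fun s hs => by
    rw [Set.uIcc_of_le (by norm_num)] at hs
    linarith [hs.1]
  have hG : AbsolutelyContinuousOnInterval (fun s => h ^ 2 / (h + s) ^ 3) 0 4 := by
    refine ContDiffOn.absolutelyContinuousOnInterval ?_
    exact contDiffOn_const.div (by fun_prop) fun s hs => pow_ne_zero _ (hne s hs)
  have hU := hu.absolutelyContinuousOnInterval_intervalIntegral (c := 0) (by simp)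
  have hparts := hG.integral_mul_deriv_eq_deriv_mul hU
  have e1 : ∫ s in (0 : ℝ)..4, h ^ 2 / (h + s) ^ 3 * deriv (fun x => ∫ v in (0 : ℝ)..x, u v) s =
      ∫ s in (0 : ℝ)..4, h ^ 2 / (h + s) ^ 3 * u s := by
    refine intervalIntegral.integral_congr_ae ?_
    filter_upwards [hu.ae_hasDerivAt_integral] with s hs hs'
    rw [(hs (Set.uIoc_subset_uIcc hs') 0 (by simp)).deriv]
  have hGd : ∀ s ∈ Set.uIcc (0 : ℝ) 4,
      HasDerivAt (fun s => h ^ 2 / (h + s) ^ 3) (-(3 * h ^ 2 / (h + s) ^ 4)) s := fun s hs => by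
    have := hne s hs
    have h1 := (hasDerivAt_const s (h ^ 2)).div (((hasDerivAt_id s).const_add h).pow 3)
      (pow_ne_zero _ this)
    convert! h1 using 1
    simp only [id, Pi.pow_apply]
    field_simp
    ring
  have hFd : ∀ s ∈ Set.uIcc (0 : ℝ) 4,
      HasDerivAt (fun s => -(3 * M * h / (h + s))) (3 * M * h / (h + s) ^ 2) s := fun s hs => by
    have := hne s hs
    have h1 := ((hasDerivAt_const s (3 * M * h)).div ((hasDerivAt_id s).const_add h) this).neg
    convert! h1 using 1
    simp only [id]
    field_simp
    ring
  have hFi : IntervalIntegrable (fun s => 3 * M * h / (h + s) ^ 2) volume 0 4 :=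
    ContinuousOn.intervalIntegrable
      (continuousOn_const.div (by fun_prop) fun s hs => pow_ne_zero _ (hne s hs))
  have e2 : -∫ s in (0 : ℝ)..4,
        deriv (fun s => h ^ 2 / (h + s) ^ 3) s * ∫ v in (0 : ℝ)..s, u v ≤
      ∫ s in (0 : ℝ)..4, 3 * M * h / (h + s) ^ 2 := by
    rw [← intervalIntegral.integral_neg]
    refine intervalIntegral.integral_mono_on (by norm_num)
      (hG.intervalIntegrable_deriv.mul_continuousOn hU.continuousOn).neg hFi fun s hs => ?_
    rw [(hGd s (by rwa [Set.uIcc_of_le (by norm_num)])).deriv]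
    have hs0 := hs.1
    have := mul_le_mul_of_nonneg_left (hgrow s hs)
      (show 0 ≤ 3 * h ^ 2 / (h + s) ^ 4 by positivity)
    have e : 3 * h ^ 2 / (h + s) ^ 4 * (M * ((h + s) ^ 2 / h)) = 3 * M * h / (h + s) ^ 2 := by
      field_simp
    linarith
  rw [intervalIntegral.integral_eq_sub_of_hasDerivAt hFd hFi] at e2
  have e3 : -(3 * M * h / (h + 4)) - -(3 * M * h / (h + 0)) ≤ 3 * M := by
    have : 3 * M * h / (h + 0) = 3 * M := by field_simp; ring
    have : 0 ≤ 3 * M * h / (h + 4) := by positivity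
    linarith
  have e4 : h ^ 2 / (h + 4) ^ 3 * ∫ r in (0 : ℝ)..4, u r ≤ M := by
    calc _ ≤ h ^ 2 / (h + 4) ^ 3 * (M * ((h + 4) ^ 2 / h)) := by
          gcongr
          exact hgrow 4 (by norm_num)
      _ = M * (h / (h + 4)) := by field_simp
      _ ≤ M := mul_le_of_le_one_right hM (by rw [div_le_one (by positivity)]; linarith)
  simp only [intervalIntegral.integral_same, mul_zero, sub_zero] at hparts
  rw [← e1, hparts]
  linarith

lemma integral_harmKernel_mul_posLog_le {h M : ℝ} (hh : 0 < h) (hh4 : h ≤ 4) (hM : 0 ≤ M)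
    {u : ℝ → ℝ} (hum : Measurable u) (hupos : ∀ s ∈ Set.Icc (0 : ℝ) 4, 0 < u s)
    (hu : IntervalIntegrable u volume 0 4)
    (hgrow : ∀ s ∈ Set.Icc (0 : ℝ) 4, ∫ r in (0 : ℝ)..s, u r ≤ M * ((h + s) ^ 2 / h)) :
    IntervalIntegrable (fun s => harmKernel h s * Real.posLog (u s)) volume 0 4 ∧
      ∫ s in (0 : ℝ)..4, harmKernel h s * Real.posLog (u s) ≤ 68 * M + 104 := by
  obtain ⟨hEi, hEle⟩ := harmError_integral hh
  have hGi : IntervalIntegrable (fun s => h ^ 2 / (h + s) ^ 3 * u s) volume 0 4 := by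
    refine hu.continuousOn_mul (continuousOn_const.div (by fun_prop) fun s hs => ?_)
    rw [Set.uIcc_of_le (by norm_num)] at hs
    have := hs.1
    positivity
  have hBi := (hGi.add (hu.const_mul h)).add hEi
  have hbound : ∀ s ∈ Set.Ioo (0 : ℝ) 4, harmKernel h s * Real.posLog (u s) ≤
      h ^ 2 / (h + s) ^ 3 * u s + h * u s + harmError h s := fun s hs =>
    harmKernel_mul_posLog_le hh hh4 hs (hupos s ⟨hs.1.le, hs.2.le⟩)
  have hint : IntervalIntegrable (fun s => harmKernel h s * Real.posLog (u s)) volume 0 4 := by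
    rw [intervalIntegrable_iff_integrableOn_Ioo_of_le (by norm_num)] at hBi ⊢
    refine hBi.mono' ((measurable_harmKernel h).mul
      (Real.continuous_posLog.measurable.comp hum)).aestronglyMeasurable ?_
    filter_upwards [ae_restrict_mem measurableSet_Ioo] with s hs
    rw [Real.norm_of_nonneg (mul_nonneg (harmKernel_nonneg hh hs.1) Real.posLog_nonneg)]
    exact hbound s hs
  refine ⟨hint, ?_⟩
  have hmono := intervalIntegral.integral_mono_on_of_le_Ioo (by norm_num) hint hBi hbound
  rw [intervalIntegral.integral_add (hGi.add (hu.const_mul h)) hEi,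
    intervalIntegral.integral_add hGi (hu.const_mul h),
    intervalIntegral.integral_const_mul] at hmono
  have h1 := integral_concentrated_weight_le hh hM hu hgrow
  have h2 : h * ∫ s in (0 : ℝ)..4, u s ≤ 64 * M := by
    calc _ ≤ h * (M * ((h + 4) ^ 2 / h)) := by
          gcongr
          exact hgrow 4 (by norm_num)
      _ = (h + 4) ^ 2 * M := by field_simp
      _ ≤ (4 + 4) ^ 2 * M := by gcongr
      _ = 64 * M := by norm_num
  linarith

lemma integral_pos_and_mono {v : ℝ → ℝ} (hvpos : ∀ s ∈ Set.Icc (0 : ℝ) 4, 0 < v s)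
    (hv : IntervalIntegrable v volume 0 4) {a b : ℝ} (ha : 0 < a) (hab : a ≤ b) (hb : b ≤ 4) :
    0 < ∫ r in (0 : ℝ)..a, v r ∧ ∫ r in (0 : ℝ)..a, v r ≤ ∫ r in (0 : ℝ)..b, v r := by
  have hsub : ∀ {c}, 0 ≤ c → c ≤ 4 → IntervalIntegrable v volume 0 c := fun h0 h4 =>
    hv.mono_set (by rw [Set.uIcc_of_le h0, Set.uIcc_of_le (by norm_num)]
                    exact Set.Icc_subset_Icc_right h4)
  constructor
  · refine intervalIntegral.intervalIntegral_pos_of_pos_on (hsub ha.le (hab.trans hb)) ?_ ha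
    intro s hs
    exact hvpos s ⟨hs.1.le, by linarith [hs.2]⟩
  · refine intervalIntegral.integral_mono_interval le_rfl ha.le hab ?_ (hsub (ha.le.trans hab) hb)
    filter_upwards [ae_restrict_mem measurableSet_Ioc] with s hs
    exact (hvpos s ⟨hs.1.le, hs.2.trans hb⟩).le

/-- The Cauchy–Schwarz lower bound for the `A₂` product. -/
lemma sq_le_integral_mul_integral_inv {v : ℝ → ℝ} {a : ℝ} (ha : 0 ≤ a)
    (hvpos : ∀ s ∈ Set.Icc (0 : ℝ) a, 0 < v s) (hv : IntervalIntegrable v volume 0 a)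
    (hvi : IntervalIntegrable (fun s => (v s)⁻¹) volume 0 a)
    (hpos : 0 < ∫ r in (0 : ℝ)..a, v r) :
    a ^ 2 ≤ (∫ r in (0 : ℝ)..a, v r) * ∫ r in (0 : ℝ)..a, (v r)⁻¹ := by
  set V := ∫ r in (0 : ℝ)..a, v r
  set l := a / V
  have hmono : ∫ r in (0 : ℝ)..a, (2 * l - l ^ 2 * v r) ≤ ∫ r in (0 : ℝ)..a, (v r)⁻¹ := by
    refine intervalIntegral.integral_mono_on ha
      (intervalIntegrable_const.sub (hv.const_mul _)) hvi fun s hs => ?_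
    have hs' := hvpos s hs
    rw [← sub_nonneg]
    have : (v s)⁻¹ - (2 * l - l ^ 2 * v s) = (l * v s - 1) ^ 2 / v s := by
      field_simp; ring
    rw [this]
    positivity
  rw [intervalIntegral.integral_sub intervalIntegrable_const (hv.const_mul _),
    intervalIntegral.integral_const, intervalIntegral.integral_const_mul] at hmono
  have e : (a - 0) • (2 * l) - l ^ 2 * V = a ^ 2 / V := by
    simp only [l, smul_eq_mul]; field_simp; ring
  rw [e, div_le_iff₀ hpos] at hmono
  linarith

lemma growth_of_A2 {v : ℝ → ℝ} {K : ℝ} (hvpos : ∀ s ∈ Set.Icc (0 : ℝ) 4, 0 < v s)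
    (hv : IntervalIntegrable v volume 0 4)
    (hvi : IntervalIntegrable (fun s => (v s)⁻¹) volume 0 4)
    (hA : ∀ s, 0 < s → s ≤ 4 →
      (∫ r in (0 : ℝ)..s, v r) * ∫ r in (0 : ℝ)..s, (v r)⁻¹ ≤ K * s ^ 2)
    {h s : ℝ} (hh : 0 < h) (hhs : h ≤ s) (hs : s ≤ 4) :
    (∫ r in (0 : ℝ)..s, v r) * h ^ 2 ≤ K * s ^ 2 * ∫ r in (0 : ℝ)..h, v r := by
  have hsub : Set.uIcc (0 : ℝ) h ⊆ Set.uIcc 0 4 := by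
    rw [Set.uIcc_of_le hh.le, Set.uIcc_of_le (by norm_num)]
    exact Set.Icc_subset_Icc_right (hhs.trans hs)
  obtain ⟨p1, p2⟩ := integral_pos_and_mono hvpos hv hh hhs hs
  obtain ⟨-, q2⟩ := integral_pos_and_mono (fun s hs => inv_pos.2 (hvpos s hs)) hvi hh hhs hs
  have hcs := sq_le_integral_mul_integral_inv hh.le
    (fun r hr => hvpos r ⟨hr.1, hr.2.trans (hhs.trans hs)⟩) (hv.mono_set hsub)
    (hvi.mono_set hsub) p1
  have hAs := hA s (hh.trans_le hhs) hs
  have p3 := p1.trans_le p2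
  set V := ∫ r in (0 : ℝ)..h, v r
  set W := ∫ r in (0 : ℝ)..s, v r
  set V' := ∫ r in (0 : ℝ)..h, (v r)⁻¹
  set W' := ∫ r in (0 : ℝ)..s, (v r)⁻¹
  calc W * h ^ 2 ≤ W * (V * V') := by gcongr
    _ ≤ W * (V * W') := by gcongr
    _ = (W * W') * V := by ring
    _ ≤ K * s ^ 2 * V := by gcongr

/-- The logarithmic harmonic mean of a weight with polynomially growing primitive is at most the
logarithm of its average over the interval of the corresponding scale, up to a constant. -/
lemma integral_harmKernel_mul_log_le {h K : ℝ} (hh : 0 < h) (hh4 : h ≤ 4) (hK : 1 ≤ K)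
    {v : ℝ → ℝ} (hvm : Measurable v) (hvpos : ∀ s ∈ Set.Icc (0 : ℝ) 4, 0 < v s)
    (hv : IntervalIntegrable v volume 0 4)
    (hvi : IntervalIntegrable (fun s => (v s)⁻¹) volume 0 4)
    (hgrow : ∀ s, h ≤ s → s ≤ 4 →
      (∫ r in (0 : ℝ)..s, v r) * h ^ 2 ≤ K * s ^ 2 * ∫ r in (0 : ℝ)..h, v r) :
    ∫ s in (0 : ℝ)..4, harmKernel h s * Real.log (v s) ≤
      Real.log (h⁻¹ * ∫ r in (0 : ℝ)..h, v r) + (68 * K + 104) := by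
  have hVpos := (integral_pos_and_mono hvpos hv hh le_rfl hh4).1
  set V := ∫ r in (0 : ℝ)..h, v r with hV
  set A := h⁻¹ * V with hA
  have hA0 : 0 < A := by positivity
  obtain ⟨hi1, hle1⟩ := integral_harmKernel_mul_posLog_le (u := fun s => A⁻¹ * v s) hh hh4
    (zero_le_one.trans hK) (hvm.const_mul _)
    (fun s hs => mul_pos (inv_pos.2 hA0) (hvpos s hs)) (hv.const_mul _) (by
      intro s hs
      have hK0 : 0 < K := by linarith
      have hs0 := hs.1
      rw [intervalIntegral.integral_const_mul, hA, mul_inv, inv_inv]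
      rcases le_total h s with hsh | hsh
      · have := hgrow s hsh hs.2
        calc h * V⁻¹ * ∫ r in (0 : ℝ)..s, v r
            = (h * V)⁻¹ * ((∫ r in (0 : ℝ)..s, v r) * h ^ 2) := by field_simp
          _ ≤ (h * V)⁻¹ * (K * s ^ 2 * V) := by gcongr
          _ = K * (s ^ 2 / h) := by field_simp
          _ ≤ K * ((h + s) ^ 2 / h) := by gcongr; linarith
      · have hVs : ∫ r in (0 : ℝ)..s, v r ≤ V := by
          rcases hs0.eq_or_lt with rfl | hs0
          · simpa using hVpos.le
          · exact (integral_pos_and_mono hvpos hv hs0 hsh hh4).2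
        calc h * V⁻¹ * ∫ r in (0 : ℝ)..s, v r ≤ h * V⁻¹ * V := by gcongr
          _ = 1 * (h ^ 2 / h) := by field_simp
          _ ≤ K * ((h + s) ^ 2 / h) := by gcongr; linarith)
  have hI := (integral_pos_and_mono (fun s hs => inv_pos.2 (hvpos s hs)) hvi
    (show (0 : ℝ) < 4 by norm_num) le_rfl le_rfl).1
  set J := ∫ r in (0 : ℝ)..4, (v r)⁻¹ with hJ
  obtain ⟨hi2, -⟩ := integral_harmKernel_mul_posLog_le (u := fun s => A * (v s)⁻¹) hh hh4
    (M := A * J / h) (by positivity) (hvm.inv.const_mul _)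
    (fun s hs => mul_pos hA0 (inv_pos.2 (hvpos s hs))) (hvi.const_mul _) (by
      intro s hs
      have hs0 := hs.1
      have hJs : ∫ r in (0 : ℝ)..s, (v r)⁻¹ ≤ J := by
        rcases hs0.eq_or_lt with rfl | hs0
        · simpa using hI.le
        · exact (integral_pos_and_mono (fun s hs => inv_pos.2 (hvpos s hs)) hvi hs0 hs.2 le_rfl).2
      rw [intervalIntegral.integral_const_mul]
      calc A * ∫ r in (0 : ℝ)..s, (v r)⁻¹ ≤ A * J := by gcongr
        _ = A * J / h * (h ^ 2 / h) := by field_simp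
        _ ≤ A * J / h * ((h + s) ^ 2 / h) := by gcongr; linarith)
  have hki := (intervalIntegrable_harmKernel hh).mul_const (Real.log A)
  have hdec : ∫ s in (0 : ℝ)..4, harmKernel h s * Real.log (v s) =
      ∫ s in (0 : ℝ)..4, ((harmKernel h s * Real.log A +
        harmKernel h s * Real.posLog (A⁻¹ * v s)) -
        harmKernel h s * Real.posLog (A * (v s)⁻¹)) := by
    refine intervalIntegral.integral_congr fun s hs => ?_
    rw [Set.uIcc_of_le (by norm_num)] at hs
    have h1 : Real.log (A⁻¹ * v s) = Real.log (v s) - Real.log A := by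
      rw [Real.log_mul (by positivity) (hvpos s hs).ne', Real.log_inv]
      ring
    have h2 := Real.posLog_sub_posLog_inv (x := A⁻¹ * v s)
    rw [mul_inv A⁻¹, inv_inv, h1] at h2
    linear_combination (-harmKernel h s) * h2
  rw [hdec, intervalIntegral.integral_sub (hki.add hi1) hi2,
    intervalIntegral.integral_add hki hi1, intervalIntegral.integral_mul_const,
    integral_harmKernel hh]
  have : 0 ≤ ∫ s in (0 : ℝ)..4, harmKernel h s * Real.posLog (A * (v s)⁻¹) :=
    intervalIntegral.integral_nonneg (by norm_num) fun s hs => by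
      rcases hs.1.eq_or_lt with rfl | hs0
      · simp [harmKernel]
      · exact mul_nonneg (harmKernel_nonneg hh hs0) Real.posLog_nonneg
  linarith

lemma integral_comp_two_sub (f : ℝ → ℝ) (a : ℝ) :
    ∫ s in (0 : ℝ)..a, f (2 - s) = ∫ t in (2 - a)..2, f t := by
  rw [intervalIntegral.integral_comp_sub_left, sub_zero]

lemma intervalIntegrable_comp_two_sub {f : ℝ → ℝ} (hf : IntervalIntegrable f volume (-2) 2) :
    IntervalIntegrable (fun s => f (2 - s)) volume 0 4 := by
  have := hf.comp_sub_left 2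
  norm_num at this
  exact this.symm

lemma ofReal_cpow_half {r : ℝ} (hr : 0 ≤ r) : (r : ℂ) ^ ((1 : ℂ) / 2) = (√r : ℝ) := by
  rw [Real.sqrt_eq_rpow, Complex.ofReal_cpow hr]
  norm_num

lemma sqrtZsq_ofReal {x : ℝ} (hx : 2 < x) :
    sqrtZsq x = (√((x - 2) * (x - 2 + 4)) : ℝ) := by
  have h1 : ((x : ℂ) - 2) = ((x - 2 : ℝ) : ℂ) := by push_cast; ring
  have h2 : ((x : ℂ) + 2) = ((x - 2 + 4 : ℝ) : ℂ) := by push_cast; ring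
  rw [sqrtZsq, h1, h2, ofReal_cpow_half (by linarith), ofReal_cpow_half (by linarith),
    Real.sqrt_mul (by linarith), Complex.ofReal_mul]

lemma norm_szegoOuter_sq (w : ℝ → ℝ) {x : ℝ} (hx : 2 < x) :
    ‖szegoOuter w x‖ ^ 2 =
      Real.exp (∫ s in (0 : ℝ)..4, harmKernel (x - 2) s * Real.log (w (2 - s))) := by
  have e1 : (∫ t in (-2 : ℝ)..2, (Real.log (w t) : ℂ) / (((x : ℂ) - (t : ℂ)) * (√(4 - t ^ 2) : ℝ))) =
      ((∫ t in (-2 : ℝ)..2, Real.log (w t) / ((x - t) * √(4 - t ^ 2)) : ℝ) : ℂ) := by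
    rw [← intervalIntegral.integral_ofReal]
    congr 1
    funext t
    push_cast
    rfl
  have e2 : ∫ s in (0 : ℝ)..4, harmKernel (x - 2) s * Real.log (w (2 - s)) =
      √((x - 2) * (x - 2 + 4)) / π *
        ∫ t in (-2 : ℝ)..2, Real.log (w t) / ((x - t) * √(4 - t ^ 2)) := by
    have := integral_comp_two_sub (fun t => Real.log (w t) / ((x - t) * √(4 - t ^ 2))) 4
    norm_num at this
    rw [← this, ← intervalIntegral.integral_const_mul]
    congr 1
    funext s
    rw [harmKernel, show x - 2 + s = x - (2 - s) by ring,
      show s * (4 - s) = 4 - (2 - s) ^ 2 by ring]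
    simp only [div_eq_mul_inv, mul_inv]
    ring
  rw [szegoOuter, Complex.norm_exp, sqrtZsq_ofReal hx, e1, ← Real.exp_nat_mul, e2]
  congr 1
  rw [← Complex.ofReal_ofNat, ← Complex.ofReal_mul, ← Complex.ofReal_div, ← Complex.ofReal_mul,
    Complex.ofReal_re]
  push_cast
  field_simp

/-- Let 𝔴̃ ∈ A₂[-2,2] and let φ be the outer function in Ω = ℂ̄∖[-2,2]
with |φ|² = 𝔴̃ on [-2,2] and φ(∞) > 0.  Then for x > 2 (with 4-x ≥ -2) one has, with
constants 0 < c < C < ∞ independent of x,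
c·(x-2)⁻¹·∫_{4-x}^2 𝔴̃ ≤ |φ(x)|² ≤ C·(x-2)⁻¹·∫_{4-x}^2 𝔴̃. -/
theorem outer_function_two_sided_estimate (w : ℝ → ℝ)
    (hpos : ∀ t ∈ Set.Icc (-2:ℝ) 2, 0 < w t)
    (hmeas : Measurable w)
    (hint : IntervalIntegrable w volume (-2) 2)
    (hintinv : IntervalIntegrable (fun t => (w t)⁻¹) volume (-2) 2)
    (hA2 : A2onSegment w) :
    ∃ c C : ℝ, 0 < c ∧ c < C ∧
      ∀ x : ℝ, 2 < x → x ≤ 6 →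
        c * ((x - 2)⁻¹ * ∫ t in (4 - x)..2, w t) ≤ ‖szegoOuter w (x:ℂ)‖^2 ∧
        ‖szegoOuter w (x:ℂ)‖^2 ≤ C * ((x - 2)⁻¹ * ∫ t in (4 - x)..2, w t) := by
  obtain ⟨C, hC⟩ := hA2
  set K := max C 1
  have hK : 1 ≤ K := le_max_right _ _
  set v := fun s => w (2 - s)
  have hvm : Measurable v := hmeas.comp (measurable_const.sub measurable_id)
  have hvpos : ∀ s ∈ Set.Icc (0 : ℝ) 4, 0 < v s := fun s hs =>
    hpos _ ⟨by linarith [hs.2], by linarith [hs.1]⟩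
  have hv : IntervalIntegrable v volume 0 4 := intervalIntegrable_comp_two_sub hint
  have hvi : IntervalIntegrable (fun s => (v s)⁻¹) volume 0 4 :=
    intervalIntegrable_comp_two_sub hintinv
  have hA : ∀ s, 0 < s → s ≤ 4 →
      (∫ r in (0 : ℝ)..s, v r) * ∫ r in (0 : ℝ)..s, (v r)⁻¹ ≤ K * s ^ 2 := by
    intro s hs hs4
    have := hC (2 - s) 2 (by linarith) (by linarith) le_rfl
    rw [← integral_comp_two_sub w, ← integral_comp_two_sub (fun t => (w t)⁻¹),
      show 2 - (2 - s) = s by ring] at this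
    have h1 := mul_le_mul_of_nonneg_right (this.trans (le_max_left C 1)) (sq_nonneg s)
    calc _ = s⁻¹ * (∫ r in (0 : ℝ)..s, v r) * (s⁻¹ * ∫ r in (0 : ℝ)..s, (v r)⁻¹) * s ^ 2 := by
          field_simp
      _ ≤ _ := h1
  have hvpos' : ∀ s ∈ Set.Icc (0 : ℝ) 4, 0 < (v s)⁻¹ := fun s hs => inv_pos.2 (hvpos s hs)
  set E := Real.exp (68 * K + 104)
  have hE : 1 < E := Real.one_lt_exp_iff.2 (by linarith)
  refine ⟨(E * K)⁻¹, E, by positivity, ?_, fun x hx hx6 => ?_⟩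
  · refine (inv_le_one_of_one_le₀ ?_).trans_lt hE
    exact one_le_mul_of_one_le_of_one_le hE.le hK
  set h := x - 2 with hdef
  have hh : 0 < h := by linarith
  have hh4 : h ≤ 4 := by linarith
  have hup := integral_harmKernel_mul_log_le hh hh4 hK hvm hvpos hv hvi
    fun s h1 h2 => growth_of_A2 hvpos hv hvi hA hh h1 h2
  have hlow := integral_harmKernel_mul_log_le hh hh4 hK hvm.inv hvpos' hvi
    (by simpa only [Pi.inv_apply, inv_inv] using hv)
    fun s h1 h2 => growth_of_A2 hvpos' hvi (by simpa only [inv_inv] using hv)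
      (fun s h1 h2 => by simpa only [inv_inv, mul_comm] using hA s h1 h2) hh h1 h2
  have hV := (integral_pos_and_mono hvpos hv hh le_rfl hh4).1
  have hV' := (integral_pos_and_mono hvpos' hvi hh le_rfl hh4).1
  have hprod := hA h hh hh4
  have eV : ∫ t in (4 - x)..2, w t = ∫ r in (0 : ℝ)..h, v r := by
    rw [integral_comp_two_sub w, show 2 - h = 4 - x by rw [hdef]; ring]
  rw [norm_szegoOuter_sq w hx, eV]
  simp only [Pi.inv_apply, Real.log_inv, mul_neg, intervalIntegral.integral_neg] at hlow
  set V := ∫ r in (0 : ℝ)..h, v r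
  set V' := ∫ r in (0 : ℝ)..h, (v r)⁻¹
  constructor
  · have h1 := Real.exp_le_exp.2 hlow
    rw [Real.exp_neg, Real.exp_add, Real.exp_log (by positivity)] at h1
    rw [inv_le_comm₀ (Real.exp_pos _) (by positivity)] at h1
    refine le_trans ?_ h1
    change _ ≤ (h⁻¹ * V' * E)⁻¹
    rw [show (E * K)⁻¹ * (h⁻¹ * V) = V / (E * K * h) by field_simp,
      show (h⁻¹ * V' * E)⁻¹ = h / (V' * E) by field_simp,
      div_le_div_iff₀ (by positivity) (by positivity)]
    nlinarith [mul_le_mul_of_nonneg_left hprod (zero_le_one.trans hE.le)]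
  · have h1 := Real.exp_le_exp.2 hup
    rw [Real.exp_add, Real.exp_log (by positivity)] at h1
    linarith

end
end
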